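/- arXiv:2510.13564 — 2 statements merged into one kernel-verified Lean document; each statement's English description precedes it below -/
import Mathlib

section
/- A Serre microfibration whose fibers are all weakly contractible is a Serre fibration, and hence a weak homotopy equivalence onto its image components. -/
open scoped unitInterval Topology.Homotopy

noncomputable section

/-- The map induced on homotopy groups by a continuous map. -/
def homotopyGroupMap (N : Type) {X Y : Type} [TopologicalSpace X] [TopologicalSpace Y]
    (f : C(X, Y)) (x : X) : HomotopyGroup N X x → HomotopyGroup N Y (f x) :=
  Quotient.map
    (fun p => (⟨f.comp p.1, fun y hy => by
        simp only [ContinuousMap.comp_apply]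
        rw [p.2 y hy]⟩ : GenLoop N Y (f x)))
    (fun p q h => h.map fun H => H.compContinuousMap f)

/-- A space is weakly contractible if it is nonempty and all its homotopy groups
(including `π₀`) are trivial at every basepoint. -/
def WeaklyContractible (X : Type) [TopologicalSpace X] : Prop :=
  Nonempty X ∧ ∀ (n : ℕ) (x : X), Subsingleton (HomotopyGroup (Fin n) X x)

/-- A continuous map is a weak homotopy equivalence if it induces bijections on all
homotopy groups (including `π₀`) at all basepoints. -/
def IsWeakHomotopyEquiv {X Y : Type} [TopologicalSpace X] [TopologicalSpace Y]
    (f : C(X, Y)) : Prop :=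
  (Nonempty Y → Nonempty X) ∧
    ∀ (n : ℕ) (x : X), Function.Bijective (homotopyGroupMap (Fin n) f x)

/-- `f` is an `n`-connected map: it induces isomorphisms on homotopy groups in degrees
below `n` and a surjection in degree `n`, at all basepoints. -/
def IsNConnectedMap {X Y : Type} [TopologicalSpace X] [TopologicalSpace Y]
    (n : ℕ) (f : C(X, Y)) : Prop :=
  (Nonempty Y → Nonempty X) ∧
    (∀ (i : ℕ) (x : X), i < n → Function.Bijective (homotopyGroupMap (Fin i) f x)) ∧
    ∀ x : X, Function.Surjective (homotopyGroupMap (Fin n) f x)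

/-- Two spaces are weakly (homotopy) equivalent if they are connected by a zigzag of weak
homotopy equivalences. -/
def WeaklyEquivalent (X Y : Type) [TopologicalSpace X] [TopologicalSpace Y] : Prop :=
  ∃ (Z : Type) (_ : TopologicalSpace Z) (f : C(Z, X)) (g : C(Z, Y)),
    IsWeakHomotopyEquiv f ∧ IsWeakHomotopyEquiv g


/-- `p` is a Serre fibration: lifting problems of cubes `I^k × [0,1]` have full lifts. -/
def IsSerreFibration {E B : Type} [TopologicalSpace E] [TopologicalSpace B]
    (p : C(E, B)) : Prop :=
  ∀ (k : ℕ) (F : C((Fin k → I) × I, B)) (g : C(Fin k → I, E)),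
    (∀ y, p (g y) = F (y, 0)) →
    ∃ G : C((Fin k → I) × I, E), (∀ y, G (y, 0) = g y) ∧ ∀ z, p (G z) = F z

/-- `p` is a Serre microfibration: lifting problems of cubes `I^k × [0,1]` admit partial
lifts defined for times `t ≤ ε`, for some `ε > 0`. -/
def IsSerreMicrofibration {E B : Type} [TopologicalSpace E] [TopologicalSpace B]
    (p : C(E, B)) : Prop :=
  ∀ (k : ℕ) (F : C((Fin k → I) × I, B)) (g : C(Fin k → I, E)),
    (∀ y, p (g y) = F (y, 0)) →
    ∃ ε : ℝ, 0 < ε ∧ ∃ G : C((Fin k → I) × I, E),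
      (∀ y, G (y, 0) = g y) ∧ ∀ y (t : I), (t : ℝ) ≤ ε → p (G (y, t)) = F (y, t)

/-! ### Retracts, cubes and partial lifts -/

/-- `L` is a retract of the ambient space. -/
def IsRetr {Z : Type} [TopologicalSpace Z] (L : Set Z) : Prop :=
  ∃ ρ : C(Z, Z), (∀ z, ρ z ∈ L) ∧ ∀ z ∈ L, ρ z = z

/-- `Z` is homeomorphic to a finite-dimensional cube. -/
def IsCube (Z : Type) [TopologicalSpace Z] : Prop :=
  ∃ N : ℕ, Nonempty (Z ≃ₜ (Fin N → I))

/-- Splitting off the coordinate `t` of a cube. -/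
def splitCoord {n : ℕ} (t : Fin (n + 1)) : (Fin (n + 1) → I) ≃ₜ (Fin n → I) × I where
  toFun z := (fun j => z (t.succAbove j), z t)
  invFun w := t.insertNth w.2 w.1
  left_inv z := by
    simp only
    rw [Fin.insertNth_eq_iff]
    exact ⟨rfl, rfl⟩
  right_inv w := by
    ext <;> simp
  continuous_toFun := by fun_prop
  continuous_invFun := by
    exact Continuous.finInsertNth t continuous_snd continuous_fst

theorem isCube_pi (n : ℕ) : IsCube (Fin n → I) := ⟨n, ⟨Homeomorph.refl _⟩⟩

theorem IsCube.prod {Z : Type} [TopologicalSpace Z] (h : IsCube Z) : IsCube (Z × I) := by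
  obtain ⟨N, ⟨e⟩⟩ := h
  exact ⟨N + 1, ⟨(e.prodCongr (Homeomorph.refl I)).trans (splitCoord 0).symm⟩⟩

theorem isCube_I : IsCube I := ⟨1, ⟨(Homeomorph.funUnique (Fin 1) I).symm⟩⟩

theorem IsCube.congr {Z W : Type} [TopologicalSpace Z] [TopologicalSpace W] (h : IsCube Z)
    (e : W ≃ₜ Z) : IsCube W := by
  obtain ⟨N, ⟨f⟩⟩ := h
  exact ⟨N, ⟨e.trans f⟩⟩

/-- projection of the reals to the unit interval -/
def cl (x : ℝ) : I := Set.projIcc (0 : ℝ) 1 zero_le_one x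

@[fun_prop]
theorem continuous_cl : Continuous cl := continuous_projIcc (h := zero_le_one)

theorem cl_coe (x : I) : cl (x : ℝ) = x := Set.projIcc_val _ x

theorem cl_eq {x : ℝ} {y : I} (h : x = y) : cl x = y := by rw [h, cl_coe]

theorem cl_of_le_zero {x : ℝ} (h : x ≤ 0) : cl x = 0 := Set.projIcc_of_le_left _ h

theorem cl_of_one_le {x : ℝ} (h : 1 ≤ x) : cl x = 1 := Set.projIcc_of_right_le _ h

/-- Moving from a retract back to the identity at controlled speed. -/
theorem IsCube.pinch {Z : Type} [TopologicalSpace Z] (h : IsCube Z) {L : Set Z}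
    (hL : IsRetr L) : ∃ (ρ : C(Z, Z)) (R : C(Z × I, Z)) (d : C(Z, I)), (∀ z, ρ z ∈ L) ∧
      (∀ z ∈ L, ρ z = z) ∧ (∀ z ∈ L, d z = 0) ∧ (∀ z, R (z, 0) = ρ z) ∧
      ∀ z, R (z, d z) = z := by
  obtain ⟨N, ⟨e⟩⟩ := h
  obtain ⟨ρ, h1, h2⟩ := hL
  let R' : Z × I → (Fin N → I) := fun w i =>
    cl ((e (ρ w.1) i : ℝ) + max (-(w.2 : ℝ)) (min (w.2 : ℝ) ((e w.1 i : ℝ) - e (ρ w.1) i)))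
  have hR' : Continuous R' := by
    refine continuous_pi fun i => ?_
    have h3 : Continuous fun w : Z × I => e (ρ w.1) i :=
      (continuous_apply i).comp (e.continuous.comp (ρ.continuous.comp continuous_fst))
    have h4 : Continuous fun w : Z × I => e w.1 i :=
      (continuous_apply i).comp (e.continuous.comp continuous_fst)
    have h5 : Continuous fun w : Z × I => (w.2 : ℝ) := continuous_subtype_val.comp continuous_snd
    have h3' := continuous_subtype_val.comp h3
    have h4' := continuous_subtype_val.comp h4
    exact continuous_cl.comp (h3'.add (h5.neg.max (h5.min (h4'.sub h3'))))
  refine ⟨ρ, ⟨fun w => e.symm (R' w), e.symm.continuous.comp hR'⟩,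
    ⟨fun z => cl (dist (e z) (e (ρ z))), ?_⟩, h1, h2, ?_, ?_, ?_⟩
  · exact continuous_cl.comp (e.continuous.dist (e.continuous.comp ρ.continuous))
  · intro z hz
    simp only [ContinuousMap.coe_mk, h2 z hz, dist_self]
    exact cl_of_le_zero le_rfl
  · intro z
    simp only [ContinuousMap.coe_mk]
    rw [Homeomorph.symm_apply_eq]
    funext i
    refine cl_eq ?_
    simp
  · intro z
    simp only [ContinuousMap.coe_mk]
    rw [Homeomorph.symm_apply_eq]
    funext i
    refine cl_eq ?_
    have hd : dist (e z) (e (ρ z)) ≤ 1 := by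
      rw [dist_pi_le_iff zero_le_one]
      intro j
      rw [Subtype.dist_eq, Real.dist_eq, abs_le]
      have := (e z j).2.1; have := (e z j).2.2
      have := (e (ρ z) j).2.1; have := (e (ρ z) j).2.2
      constructor <;> linarith
    have hcl : ((cl (dist (e z) (e (ρ z))) : I) : ℝ) = dist (e z) (e (ρ z)) := by
      have := cl_coe ⟨dist (e z) (e (ρ z)), dist_nonneg, hd⟩
      exact congrArg Subtype.val this
    have hi : |(e z i : ℝ) - e (ρ z) i| ≤ dist (e z) (e (ρ z)) := by
      have := dist_le_pi_dist (e z) (e (ρ z)) i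
      rwa [Subtype.dist_eq, Real.dist_eq] at this
    simp only
    rw [hcl]
    rw [abs_le] at hi
    rw [min_eq_right hi.2, max_eq_right hi.1]
    ring

/-- A micro-lifting lemma relative to a retract of a cube. -/
theorem micro_retr {E B : Type} [TopologicalSpace E] [TopologicalSpace B] {p : C(E, B)}
    (hmicro : IsSerreMicrofibration p) {Z : Type} [TopologicalSpace Z] (hZ : IsCube Z)
    {L : Set Z} (hL : IsRetr L) (F : C(Z, B)) (g : Z → E) (hg : ContinuousOn g L)
    (hpg : ∀ z ∈ L, p (g z) = F z) :
    ∃ (G : C(Z, E)) (U : Set Z), IsOpen U ∧ L ⊆ U ∧ (∀ z ∈ L, G z = g z) ∧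
      ∀ z ∈ U, p (G z) = F z := by
  obtain ⟨ρ, R, d, h1, h2, h3, h4, h5⟩ := hZ.pinch hL
  obtain ⟨N, ⟨e⟩⟩ := hZ
  have hgρ : Continuous fun z => g (ρ z) := hg.comp_continuous ρ.continuous h1
  obtain ⟨ε, hε, G, hG1, hG2⟩ := hmicro N
    ⟨fun w => F (R (e.symm w.1, w.2)), by fun_prop⟩
    ⟨fun y => g (ρ (e.symm y)), hgρ.comp e.symm.continuous⟩
    (by intro y; simp only [ContinuousMap.coe_mk, h4]; exact hpg _ (h1 _))
  refine ⟨⟨fun z => G (e z, d z), by fun_prop⟩, {z | (d z : ℝ) < ε}, ?_, ?_, ?_, ?_⟩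
  · exact isOpen_lt (by fun_prop) continuous_const
  · intro z hz
    simp [h3 z hz, hε]
  · intro z hz
    simp [h3 z hz, hG1, h2 z hz]
  · intro z hz
    have := hG2 (e z) (d z) (le_of_lt hz)
    simpa [h5] using this

/-- Products with retracts. -/
theorem retr_prod {X Y : Type} [TopologicalSpace X] [TopologicalSpace Y] {A : Set X}
    (hA : IsRetr {w : X × I | w.1 ∈ A ∨ w.2 = 0}) (hY : IsCube Y) {Γ : Set Y}
    (hΓ : IsRetr Γ) : IsRetr {w : X × Y | w.1 ∈ A ∨ w.2 ∈ Γ} := by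
  obtain ⟨r, r1, r2⟩ := hA
  obtain ⟨ρ, R, d, h1, h2, h3, h4, h5⟩ := hY.pinch hΓ
  refine ⟨⟨fun w => ((r (w.1, d w.2)).1, R (w.2, (r (w.1, d w.2)).2)), by fun_prop⟩, ?_, ?_⟩
  · rintro ⟨x, y⟩
    rcases r1 (x, d y) with h | h
    · exact Or.inl h
    · right
      simp only [ContinuousMap.coe_mk, h, h4]
      exact h1 y
  · rintro ⟨x, y⟩ (h | h)
    · have := r2 (x, d y) (Or.inl h)
      simp [this, h5]
    · have h' := h3 y h
      have := r2 (x, d y) (Or.inr h')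
      simp only [ContinuousMap.coe_mk, this]
      rw [h5]

/-- The radial retraction of `X × I` onto `∂X × I ∪ X × 0` for a cube `X`. -/
theorem retr_box (n : ℕ) :
    IsRetr {w : (Fin n → I) × I | w.1 ∈ Cube.boundary (Fin n) ∨ w.2 = 0} := by
  let w : (Fin n → I) → (Fin n → ℝ) := fun x i => 2 * (x i : ℝ) - 1
  have hw : Continuous w := by fun_prop
  have hw1 : ∀ x, ‖w x‖ ≤ 1 := by
    intro x
    rw [pi_norm_le_iff_of_nonneg zero_le_one]
    intro i
    rw [Real.norm_eq_abs, abs_le]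
    have := (x i).2.1; have := (x i).2.2
    simp only [w]
    constructor <;> linarith
  have hwb : ∀ x ∈ Cube.boundary (Fin n), ‖w x‖ = 1 := by
    rintro x ⟨i, hi⟩
    refine le_antisymm (hw1 x) ?_
    refine le_trans ?_ (norm_le_pi_norm (w x) i)
    rcases hi with hi | hi <;> (simp [w, hi]; try norm_num)
  let lam : (Fin n → I) × I → ℝ := fun z => max ‖w z.1‖ ((2 - (z.2 : ℝ)) / 2)
  have hlam : Continuous lam := by fun_prop
  have hpos : ∀ z, 0 < lam z := by
    intro z
    refine lt_of_lt_of_le ?_ (le_max_right _ _)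
    have := z.2.2.2
    linarith
  have hne : ∀ z, lam z ≠ 0 := fun z => (hpos z).ne'
  refine ⟨⟨fun z => (fun i => cl ((1 + w z.1 i / lam z) / 2), cl (2 - (2 - (z.2 : ℝ)) / lam z)),
    ?_⟩, ?_, ?_⟩
  · refine Continuous.prodMk (continuous_pi fun i => ?_) ?_
    · refine continuous_cl.comp ?_
      have : Continuous fun z : (Fin n → I) × I => w z.1 i :=
        (continuous_apply i).comp (hw.comp continuous_fst)
      exact ((continuous_const.add (this.div hlam hne))).div_const _
    · refine continuous_cl.comp ?_
      refine continuous_const.sub (Continuous.div (by fun_prop) hlam hne)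
  · intro z
    rcases le_total ‖w z.1‖ ((2 - (z.2 : ℝ)) / 2) with h | h
    · right
      have h' : lam z = (2 - (z.2 : ℝ)) / 2 := max_eq_right h
      have h0 := hne z
      refine cl_eq ?_
      have : (2 - (z.2 : ℝ)) = 2 * lam z := by rw [h']; ring
      rw [this]
      field_simp
      simp
    · left
      have h' : lam z = ‖w z.1‖ := max_eq_left h
      have h0 := hpos z
      have : ∃ i, ‖w z.1 i‖ = ‖w z.1‖ := by
        by_contra hcon
        push Not at hcon
        have : ‖w z.1‖ < ‖w z.1‖ := by
          rw [pi_norm_lt_iff (h' ▸ h0)]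
          intro i
          exact lt_of_le_of_ne (norm_le_pi_norm _ i) (hcon i)
        exact lt_irrefl _ this
      obtain ⟨i, hi⟩ := this
      refine ⟨i, ?_⟩
      rw [← h', Real.norm_eq_abs] at hi
      rcases abs_choice (w z.1 i) with h2 | h2
      · right
        refine cl_eq ?_
        rw [← hi, h2, div_self]
        · norm_num
        · rw [← h2, hi]; exact h0.ne'
      · left
        refine cl_eq ?_
        rw [← hi, h2, div_neg, div_self]
        · norm_num
        · intro h3; rw [h2, h3] at hi; simp at hi; exact h0.ne hi
  · rintro ⟨x, s⟩ h
    have hl : lam (x, s) = 1 := by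
      have hs := s.2.1
      rcases h with h | h
      · simp only at h
        simp only [lam, hwb x h]
        rw [max_eq_left]
        linarith
      · simp only at h
        simp [lam, h, hw1 x]
    refine Prod.ext (funext fun i => cl_eq ?_) (cl_eq ?_)
    · simp only [hl, w]; ring
    · simp only [hl]; ring

/-- The staircase in the square. -/
def stair (a : I) : Set (I × I) := {w | w.1 = a ∨ (w.1 ≤ a ∧ w.2 = 0) ∨ (a ≤ w.1 ∧ w.2 = 1)}

theorem retr_point (T : I) : IsRetr ({T} : Set I) :=
  ⟨ContinuousMap.const _ T, fun _ => rfl, fun z hz => by simpa using hz.symm⟩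

theorem retr_stair (a : I) : IsRetr (stair a) := by
  let m1 : I × I → ℝ := fun w => max 0 (min ((a : ℝ) - w.1) w.2)
  let m2 : I × I → ℝ := fun w => max 0 (min ((w.1 : ℝ) - a) (1 - w.2))
  have hm1 : Continuous m1 := by fun_prop
  have hm2 : Continuous m2 := by fun_prop
  refine ⟨⟨fun w => (cl (w.1 + m1 w - m2 w), cl (w.2 - m1 w + m2 w)), by fun_prop⟩, ?_, ?_⟩
  · rintro ⟨t, u⟩
    have hu0 := u.2.1
    have hu1 := u.2.2
    rcases le_total t a with h | h
    · have h' : (t : ℝ) ≤ a := h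
      have e2 : m2 (t, u) = 0 := max_eq_left (le_trans (min_le_left _ _) (by simp; exact h))
      have e1 : m1 (t, u) = min ((a : ℝ) - t) u := max_eq_right (le_min (by linarith) hu0)
      rcases le_total ((a : ℝ) - t) u with h3 | h3
      · left
        refine cl_eq ?_
        simp only [e1, e2, min_eq_left h3]; ring
      · right; left
        refine ⟨?_, cl_eq ?_⟩
        · have : cl ((t : ℝ) + m1 (t, u) - m2 (t, u)) ≤ cl (a : ℝ) := by
            refine Set.monotone_projIcc _ ?_
            simp only [e1, e2, min_eq_right h3]; linarith
          rwa [cl_coe] at this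
        · simp only [e1, e2, min_eq_right h3]; simp
    · have h' : (a : ℝ) ≤ t := h
      have e1 : m1 (t, u) = 0 := max_eq_left (le_trans (min_le_left _ _) (by simp; exact h))
      have e2 : m2 (t, u) = min ((t : ℝ) - a) (1 - u) :=
        max_eq_right (le_min (by linarith) (by linarith))
      rcases le_total ((t : ℝ) - a) (1 - u) with h3 | h3
      · left
        refine cl_eq ?_
        simp only [e1, e2, min_eq_left h3]; ring
      · right; right
        refine ⟨?_, cl_eq ?_⟩
        · have : cl (a : ℝ) ≤ cl ((t : ℝ) + m1 (t, u) - m2 (t, u)) := by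
            refine Set.monotone_projIcc _ ?_
            simp only [e1, e2, min_eq_right h3]; linarith
          rwa [cl_coe] at this
        · simp only [e1, e2, min_eq_right h3]; simp
  · rintro ⟨t, u⟩ h
    have hu0 := u.2.1
    have hu1 := u.2.2
    have : m1 (t, u) = 0 ∧ m2 (t, u) = 0 := by
      rcases h with h | ⟨h, h2⟩ | ⟨h, h2⟩ <;> simp only at h
      · subst h
        simp [m1, m2, hu0, hu1]
      · simp only at h2; subst h2
        have h' : (t : ℝ) ≤ a := h
        refine ⟨max_eq_left (min_le_right _ _), max_eq_left (le_trans (min_le_left _ _) ?_)⟩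
        simp only; linarith
      · simp only at h2; subst h2
        have h' : (a : ℝ) ≤ t := h
        refine ⟨max_eq_left (le_trans (min_le_left _ _) ?_),
          max_eq_left (le_trans (min_le_right _ _) ?_)⟩
        · simp only; linarith
        · simp
    refine Prod.ext (cl_eq ?_) (cl_eq ?_) <;> simp [this.1, this.2]

theorem isClosed_bd (n : ℕ) : IsClosed (Cube.boundary (Fin n)) := by
  have : Cube.boundary (Fin n) = ⋃ i : Fin n, {y : Fin n → I | y i = 0 ∨ y i = 1} := by
    ext y; simp [Cube.boundary]
  rw [this]
  refine isClosed_iUnion_of_finite fun i => ?_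
  exact (isClosed_eq (by fun_prop) (by fun_prop)).union (isClosed_eq (by fun_prop) (by fun_prop))

/-- A steep function whose graph is close to the staircase. -/
theorem exists_steep (a : I) {δ : ℝ} (hδ : 0 < δ) : ∃ v : C(I, I), v 0 = 0 ∧ v 1 = 1 ∧
    ∀ t, (t ≤ a ∧ v t = 0) ∨ (a ≤ t ∧ v t = 1) ∨ dist t a < δ := by
  have key : ∃ c η : ℝ, 0 < η ∧ η < δ ∧ 0 ≤ c ∧ c + η ≤ 1 ∧ c ≤ a ∧ (a : ℝ) ≤ c + η := by
    have ha0 := a.2.1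
    rcases lt_or_eq_of_le a.2.2 with h | h
    · exact ⟨a, min (δ / 2) (1 - a), lt_min (by linarith) (by linarith),
        lt_of_le_of_lt (min_le_left _ _) (by linarith), ha0,
        by linarith [min_le_right (δ / 2) (1 - (a : ℝ))], le_rfl,
        by linarith [lt_min (show 0 < δ / 2 by linarith) (show 0 < 1 - (a : ℝ) by linarith)]⟩
    · exact ⟨1 - min (δ / 2) 1, min (δ / 2) 1, lt_min (by linarith) (by linarith),
        lt_of_le_of_lt (min_le_left _ _) (by linarith),
        by linarith [min_le_right (δ / 2) 1], by linarith,
        by linarith [lt_min (show 0 < δ / 2 by linarith) one_pos], by linarith⟩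
  obtain ⟨c, η, h1, h2, h3, h4, h5, h6⟩ := key
  refine ⟨⟨fun t => cl (((t : ℝ) - c) / η), by fun_prop⟩, ?_, ?_, ?_⟩
  · exact cl_of_le_zero (div_nonpos_of_nonpos_of_nonneg (by simpa using h3) h1.le)
  · exact cl_of_one_le (by rw [le_div_iff₀ h1]; simp; linarith)
  · intro t
    rcases le_total (t : ℝ) c with h | h
    · left
      exact ⟨Subtype.coe_le_coe.1 (h.trans h5),
        cl_of_le_zero (div_nonpos_of_nonpos_of_nonneg (by linarith) h1.le)⟩
    · right
      rcases le_total (c + η) (t : ℝ) with h' | h'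
      · left
        exact ⟨Subtype.coe_le_coe.1 (h6.trans h'),
          cl_of_one_le (by rw [le_div_iff₀ h1]; linarith)⟩
      · right
        rw [Subtype.dist_eq, Real.dist_eq, abs_lt]
        constructor <;> linarith

/-- Lifts on `A` extend. -/
def Solv {E B : Type} [TopologicalSpace E] [TopologicalSpace B] (p : C(E, B))
    {X : Type} [TopologicalSpace X] (A : Set X) (f : C(X, B)) : Prop :=
  ∀ g : X → E, ContinuousOn g A → (∀ x ∈ A, p (g x) = f x) →
    ∃ G : C(X, E), (∀ x ∈ A, G x = g x) ∧ ∀ x, p (G x) = f x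

theorem Solv.congr {E B : Type} [TopologicalSpace E] [TopologicalSpace B] {p : C(E, B)}
    {X Y : Type} [TopologicalSpace X] [TopologicalSpace Y] (e : X ≃ₜ Y) {A : Set X} {A' : Set Y}
    {f : C(X, B)} {f' : C(Y, B)} (hA : ∀ x, x ∈ A ↔ e x ∈ A') (hf : ∀ x, f x = f' (e x))
    (h : Solv p A f) : Solv p A' f' := by
  intro g hg hpg
  obtain ⟨G, h1, h2⟩ := h (g ∘ e)
    (hg.comp e.continuous.continuousOn fun x hx => (hA x).1 hx)
    (fun x hx => by rw [hf]; exact hpg _ ((hA x).1 hx))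
  refine ⟨⟨fun y => G (e.symm y), by fun_prop⟩, ?_, ?_⟩
  · intro y hy
    have := h1 (e.symm y) ((hA _).2 (by simpa using hy))
    simpa using this
  · intro y
    have := h2 (e.symm y)
    simpa [hf] using this

/-- the boundary of `X × I`. -/
def bdP (n : ℕ) : Set ((Fin n → I) × I) :=
  {w | w.1 ∈ Cube.boundary (Fin n) ∨ w.2 = 0 ∨ w.2 = 1}

theorem splitCoord_bd {n : ℕ} (t : Fin (n + 1)) (z : Fin (n + 1) → I) :
    z ∈ Cube.boundary (Fin (n + 1)) ↔ splitCoord t z ∈ bdP n := by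
  constructor
  · rintro ⟨i, hi⟩
    rcases Fin.eq_self_or_eq_succAbove t i with rfl | ⟨j, rfl⟩
    · exact Or.inr hi
    · exact Or.inl ⟨j, hi⟩
  · rintro (⟨j, hj⟩ | h)
    · exact ⟨_, hj⟩
    · exact ⟨t, h⟩

section Main

variable {E B : Type} [TopologicalSpace E] [TopologicalSpace B] {p : C(E, B)} {n : ℕ}

/-- Slices of `f`. -/
def slice (f : C((Fin n → I) × I, B)) (T : I) : C(Fin n → I, B) :=
  ⟨fun x => f (x, T), by fun_prop⟩

/-- `f` with the last coordinate frozen. -/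
def freeze (f : C((Fin n → I) × I, B)) (T : I) : C((Fin n → I) × I, B) :=
  ⟨fun w => f (w.1, T), by fun_prop⟩

theorem isClosed_A : IsClosed {w : (Fin n → I) × I | w.1 ∈ Cube.boundary (Fin n)} :=
  (isClosed_bd n).preimage continuous_fst

theorem local_lift (hmicro : IsSerreMicrofibration p) (f : C((Fin n → I) × I, B)) (T : I)
    (hT : Solv p (Cube.boundary (Fin n)) (slice f T)) (g : (Fin n → I) × I → E)
    (hg : ContinuousOn g {w | w.1 ∈ Cube.boundary (Fin n)})
    (hpg : ∀ w : (Fin n → I) × I, w.1 ∈ Cube.boundary (Fin n) → p (g w) = f w) :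
    ∃ (N : Set I) (s : C((Fin n → I) × I, E)), IsOpen N ∧ T ∈ N ∧
      (∀ w : (Fin n → I) × I, w.1 ∈ Cube.boundary (Fin n) → s w = g w) ∧
      ∀ x, ∀ t ∈ N, p (s (x, t)) = f (x, t) := by
  classical
  obtain ⟨h, h1, h2⟩ := hT (fun x => g (x, T))
    (hg.comp (by fun_prop) (fun x hx => hx)) (fun x hx => hpg (x, T) hx)
  let g' : (Fin n → I) × I → E := fun w => if w.2 = T then h w.1 else g w
  have e1 : ∀ w : (Fin n → I) × I, w.1 ∈ Cube.boundary (Fin n) → g' w = g w := by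
    rintro ⟨x, t⟩ hx
    by_cases ht : t = T
    · subst ht
      simp only [g', if_true]
      exact h1 x hx
    · simp only [g', if_neg ht]
  have e2 : ∀ w : (Fin n → I) × I, w.2 = T → g' w = h w.1 := fun w hw => if_pos hw
  have hc : ContinuousOn g' {w | w.1 ∈ Cube.boundary (Fin n) ∨ w.2 ∈ ({T} : Set I)} := by
    refine ContinuousOn.union_of_isClosed (s := {w : (Fin n → I) × _ | w.1 ∈ Cube.boundary (Fin n)})
      (t := {w : (Fin n → I) × I | w.2 ∈ ({T} : Set I)}) (hg.congr fun w hw => e1 w hw) ?_ isClosed_A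
      (isClosed_singleton.preimage continuous_snd)
    have : Continuous fun w : (Fin n → I) × I => h w.1 := by fun_prop
    exact this.continuousOn.congr fun w hw => e2 w hw
  obtain ⟨G, U, hU, hLU, hG, hpG⟩ := micro_retr hmicro (isCube_pi n).prod
    (retr_prod (retr_box n) isCube_I (retr_point T)) f g' hc (by
      rintro ⟨x, t⟩ (hx | ht)
      · rw [e1 _ hx]; exact hpg _ hx
      · have ht' : t = T := ht
        subst ht'
        rw [e2 _ rfl]; exact h2 x)
  have key : ∀ᶠ t in nhds T, ∀ x ∈ (Set.univ : Set (Fin n → I)), (x, t) ∈ U := by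
    refine isCompact_univ.eventually_forall_of_forall_eventually (P := fun t x => (x, t) ∈ U) ?_
    intro x _
    have : IsOpen {z : I × (Fin n → I) | (z.2, z.1) ∈ U} :=
      hU.preimage (continuous_snd.prodMk continuous_fst)
    exact this.mem_nhds (hLU (Or.inr rfl))
  obtain ⟨N, hN, hNo, hTN⟩ := eventually_nhds_iff.1 key
  refine ⟨N, G, hNo, hTN, ?_, ?_⟩
  · intro w hw
    rw [hG w (Or.inl hw), e1 w hw]
  · intro x t ht
    exact hpG _ (hN t ht x trivial)

theorem glue_lift (hmicro : IsSerreMicrofibration p) (f : C((Fin n → I) × I, B)) (a : I)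
    (ha : Solv p (bdP n) (freeze f a)) (g : (Fin n → I) × I → E)
    (hg : ContinuousOn g {w | w.1 ∈ Cube.boundary (Fin n)})
    (hpg : ∀ w : (Fin n → I) × I, w.1 ∈ Cube.boundary (Fin n) → p (g w) = f w)
    (s s' : C((Fin n → I) × I, E))
    (hs : ∀ x, ∀ t ≤ a, p (s (x, t)) = f (x, t)) (hs' : ∀ x t, a ≤ t → p (s' (x, t)) = f (x, t))
    (hsA : ∀ x ∈ Cube.boundary (Fin n), ∀ t ≤ a, s (x, t) = g (x, t))
    (hsA' : ∀ x ∈ Cube.boundary (Fin n), ∀ t, a ≤ t → s' (x, t) = g (x, t)) :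
    ∃ G : C((Fin n → I) × I, E), (∀ w, p (G w) = f w) ∧
      (∀ w : (Fin n → I) × I, w.1 ∈ Cube.boundary (Fin n) → G w = g w) ∧
      (∀ x, G (x, 0) = s (x, 0)) ∧ ∀ x, G (x, 1) = s' (x, 1) := by
  classical
  -- the vertical homotopy
  obtain ⟨h, h1, h2⟩ : ∃ h : C((Fin n → I) × I, E), (∀ x, h (x, 0) = s (x, a) ∧
      h (x, 1) = s' (x, a) ∧ (x ∈ Cube.boundary (Fin n) → ∀ u, h (x, u) = g (x, a))) ∧
      ∀ x u, p (h (x, u)) = f (x, a) := by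
    let k : (Fin n → I) × I → E := fun w =>
      if w.2 = 0 then s (w.1, a) else if w.2 = 1 then s' (w.1, a) else g (w.1, a)
    have k0 : ∀ w, w.2 = 0 → k w = s (w.1, a) := fun w hw => if_pos hw
    have k1 : ∀ w, w.2 = 1 → k w = s' (w.1, a) := fun w hw => by
      have : w.2 ≠ 0 := by rw [hw]; exact one_ne_zero
      simp only [k, if_neg this, if_pos hw]
    have kA : ∀ w : (Fin n → I) × I, w.1 ∈ Cube.boundary (Fin n) → k w = g (w.1, a) := by
      intro w hw
      by_cases h0 : w.2 = 0
      · rw [k0 w h0, hsA _ hw _ le_rfl]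
      by_cases h1 : w.2 = 1
      · rw [k1 w h1, hsA' _ hw _ le_rfl]
      simp only [k, if_neg h0, if_neg h1]
    have hk : ContinuousOn k (bdP n) := by
      refine ContinuousOn.union_of_isClosed (s := {w : (Fin n → I) × _ | w.1 ∈ Cube.boundary (Fin n)})
        (t := {w : (Fin n → I) × I | w.2 = 0 ∨ w.2 = 1}) ?_ ?_ isClosed_A ?_
      · have : ContinuousOn (fun w : (Fin n → I) × I => g (w.1, a))
            {w | w.1 ∈ Cube.boundary (Fin n)} := hg.comp (by fun_prop) (fun w hw => hw)
        exact this.congr fun w hw => kA w hw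
      · refine ContinuousOn.union_of_isClosed (s := {w : (Fin n → I) × I | w.2 = 0}) (t := {w : (Fin n → I) × I | w.2 = 1}) ?_ ?_ ?_ ?_
        · have : Continuous fun w : (Fin n → I) × I => s (w.1, a) := by fun_prop
          exact this.continuousOn.congr fun w hw => k0 w hw
        · have : Continuous fun w : (Fin n → I) × I => s' (w.1, a) := by fun_prop
          exact this.continuousOn.congr fun w hw => k1 w hw
        · exact isClosed_eq continuous_snd continuous_const
        · exact isClosed_eq continuous_snd continuous_const
      · exact (isClosed_eq continuous_snd continuous_const).union
          (isClosed_eq continuous_snd continuous_const)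
    obtain ⟨h, h1, h2⟩ := ha k hk (by
      rintro w (hw | hw | hw)
      · rw [kA w hw]; exact hpg (w.1, a) hw
      · rw [k0 w hw]; exact hs _ _ le_rfl
      · rw [k1 w hw]; exact hs' _ _ le_rfl)
    refine ⟨h, fun x => ⟨?_, ?_, ?_⟩, fun x u => h2 (x, u)⟩
    · rw [h1 _ (Or.inr (Or.inl rfl)), k0 _ rfl]
    · rw [h1 _ (Or.inr (Or.inr rfl)), k1 _ rfl]
    · intro hx u
      rw [h1 _ (Or.inl hx), kA _ hx]
  -- the lift on the staircase
  let sg : (Fin n → I) × (I × I) → E := fun w =>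
    if w.1 ∈ Cube.boundary (Fin n) then g (w.1, w.2.1) else
      if w.2.1 = a then h (w.1, w.2.2) else
        if w.2.1 ≤ a then s (w.1, w.2.1) else s' (w.1, w.2.1)
  have sgA : ∀ w : (Fin n → I) × (I × I), w.1 ∈ Cube.boundary (Fin n) → sg w = g (w.1, w.2.1) :=
    fun w hw => if_pos hw
  have sga : ∀ w : (Fin n → I) × (I × I), w.2.1 = a → sg w = h (w.1, w.2.2) := by
    intro w hw
    by_cases hA : w.1 ∈ Cube.boundary (Fin n)
    · rw [sgA w hA, hw, (h1 w.1).2.2 hA]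
    · simp only [sg, if_neg hA, if_pos hw]
  have sg0 : ∀ w : (Fin n → I) × (I × I), w.2.1 ≤ a ∧ w.2.2 = 0 → sg w = s (w.1, w.2.1) := by
    rintro w ⟨hw, hw0⟩
    by_cases hA : w.1 ∈ Cube.boundary (Fin n)
    · rw [sgA w hA, hsA _ hA _ hw]
    by_cases hwa : w.2.1 = a
    · rw [sga w hwa, hw0, (h1 w.1).1, hwa]
    · simp only [sg, if_neg hA, if_neg hwa, if_pos hw]
  have sg1 : ∀ w : (Fin n → I) × (I × I), a ≤ w.2.1 ∧ w.2.2 = 1 → sg w = s' (w.1, w.2.1) := by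
    rintro w ⟨hw, hw0⟩
    by_cases hA : w.1 ∈ Cube.boundary (Fin n)
    · rw [sgA w hA, hsA' _ hA _ hw]
    by_cases hwa : w.2.1 = a
    · rw [sga w hwa, hw0, (h1 w.1).2.1, hwa]
    · have : ¬ w.2.1 ≤ a := fun hle => hwa (le_antisymm hle hw)
      simp only [sg, if_neg hA, if_neg hwa, if_neg this]
  have cA : IsClosed {w : (Fin n → I) × (I × I) | w.1 ∈ Cube.boundary (Fin n)} :=
    (isClosed_bd n).preimage continuous_fst
  have ca : IsClosed {w : (Fin n → I) × (I × I) | w.2.1 = a} :=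
    isClosed_eq (by fun_prop) (by fun_prop)
  have c0 : IsClosed {w : (Fin n → I) × (I × I) | w.2.1 ≤ a ∧ w.2.2 = 0} :=
    (isClosed_le (by fun_prop) (by fun_prop)).inter (isClosed_eq (by fun_prop) (by fun_prop))
  have c1 : IsClosed {w : (Fin n → I) × (I × I) | a ≤ w.2.1 ∧ w.2.2 = 1} :=
    (isClosed_le (by fun_prop) (by fun_prop)).inter (isClosed_eq (by fun_prop) (by fun_prop))
  have hsA : ContinuousOn sg {w | w.1 ∈ Cube.boundary (Fin n) ∨ w.2 ∈ stair a} := by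
    refine ContinuousOn.union_of_isClosed (s := {w : (Fin n → I) × _ | w.1 ∈ Cube.boundary (Fin n)})
      (t := {w : (Fin n → I) × (I × I) | w.2.1 = a} ∪ ({w | w.2.1 ≤ a ∧ w.2.2 = 0} ∪ {w | a ≤ w.2.1 ∧ w.2.2 = 1}))
      ?_ (ContinuousOn.union_of_isClosed ?_ (ContinuousOn.union_of_isClosed ?_ ?_ c0 c1) ca
        (c0.union c1)) cA (ca.union (c0.union c1))
    · have : ContinuousOn (fun w : (Fin n → I) × (I × I) => g (w.1, w.2.1))
          {w | w.1 ∈ Cube.boundary (Fin n)} := hg.comp (by fun_prop) (fun w hw => hw)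
      exact this.congr fun w hw => sgA w hw
    · have : Continuous fun w : (Fin n → I) × (I × I) => h (w.1, w.2.2) := by fun_prop
      exact this.continuousOn.congr fun w hw => sga w hw
    · have : Continuous fun w : (Fin n → I) × (I × I) => s (w.1, w.2.1) := by fun_prop
      exact this.continuousOn.congr fun w hw => sg0 w hw
    · have : Continuous fun w : (Fin n → I) × (I × I) => s' (w.1, w.2.1) := by fun_prop
      exact this.continuousOn.congr fun w hw => sg1 w hw
  obtain ⟨G, U, hU, hLU, hG, hpG⟩ := micro_retr hmicro
    ((isCube_pi n).prod.prod.congr (Homeomorph.prodAssoc (Fin n → I) I I).symm)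
    (retr_prod (retr_box n) isCube_I.prod (retr_stair a))
    ⟨fun w => f (w.1, w.2.1), by fun_prop⟩ sg hsA (by
      rintro w (hw | hw | hw | hw)
      · rw [sgA w hw]; exact hpg _ hw
      · rw [sga w hw]; simp only [ContinuousMap.coe_mk, hw]; exact h2 _ _
      · rw [sg0 w hw]; exact hs _ _ hw.1
      · rw [sg1 w hw]; exact hs' _ _ hw.1)
  have key : ∀ᶠ t in nhds a, ∀ y ∈ (Set.univ : Set ((Fin n → I) × I)), (y.1, (t, y.2)) ∈ U := by
    refine isCompact_univ.eventually_forall_of_forall_eventually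
      (P := fun t (y : (Fin n → I) × I) => (y.1, (t, y.2)) ∈ U) ?_
    intro y _
    have : IsOpen {z : I × ((Fin n → I) × I) | (z.2.1, (z.1, z.2.2)) ∈ U} :=
      hU.preimage (by fun_prop)
    exact this.mem_nhds (hLU (Or.inr (Or.inl rfl)))
  obtain ⟨δ, hδ, hball⟩ := Metric.eventually_nhds_iff.1 key
  obtain ⟨v, v0, v1, hv⟩ := exists_steep a hδ
  refine ⟨⟨fun w => G (w.1, (w.2, v w.2)), by fun_prop⟩, ?_, ?_, ?_, ?_⟩
  · rintro ⟨x, t⟩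
    refine hpG (x, (t, v t)) ?_
    rcases hv t with ht | ht | ht
    · exact hLU (Or.inr (Or.inr (Or.inl ht)))
    · exact hLU (Or.inr (Or.inr (Or.inr ht)))
    · exact hball ht (x, v t) trivial
  · rintro ⟨x, t⟩ hx
    have := hG (x, (t, v t)) (Or.inl hx)
    rw [sgA _ hx] at this
    exact this
  · intro x
    have hw : ((0 : I) ≤ a ∧ v 0 = 0) := ⟨a.2.1, v0⟩
    have := hG (x, (0, v 0)) (Or.inr (Or.inr (Or.inl hw)))
    rw [sg0 _ hw] at this
    exact this
  · intro x
    have hw : (a ≤ (1 : I) ∧ v 1 = 1) := ⟨a.2.2, v1⟩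
    have := hG (x, (1, v 1)) (Or.inr (Or.inr (Or.inr hw)))
    rw [sg1 _ hw] at this
    exact this

theorem solv_step (hmicro : IsSerreMicrofibration p) (f : C((Fin n → I) × I, B))
    (h1 : ∀ T, Solv p (Cube.boundary (Fin n)) (slice f T))
    (h2 : ∀ T, Solv p (bdP n) (freeze f T)) : Solv p (bdP n) f := by
  intro g hg hpg
  have hgA : ContinuousOn g {w | w.1 ∈ Cube.boundary (Fin n)} := hg.mono fun w hw => Or.inl hw
  have hpgA : ∀ w : (Fin n → I) × I, w.1 ∈ Cube.boundary (Fin n) → p (g w) = f w :=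
    fun w hw => hpg w (Or.inl hw)
  have hg0 : Continuous fun w : (Fin n → I) × I => g (w.1, 0) :=
    hg.comp_continuous (by fun_prop) fun w => Or.inr (Or.inl rfl)
  have hg1 : Continuous fun w : (Fin n → I) × I => g (w.1, 1) :=
    hg.comp_continuous (by fun_prop) fun w => Or.inr (Or.inr rfl)
  choose N loc hNo hTN hloc1 hloc2 using fun T => local_lift hmicro f T (h1 T) g hgA hpgA
  obtain ⟨t, t0, tm, ⟨m, hm⟩, ht⟩ := exists_monotone_Icc_subset_open_cover_unitInterval
    hNo (fun T _ => Set.mem_iUnion.2 ⟨T, hTN T⟩)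
  have claim : ∀ k, ∃ s : C((Fin n → I) × I, E), (∀ x, ∀ u ≤ t k, p (s (x, u)) = f (x, u)) ∧
      (∀ x ∈ Cube.boundary (Fin n), ∀ u ≤ t k, s (x, u) = g (x, u)) ∧
      ∀ x, s (x, 0) = g (x, 0) := by
    intro k
    induction k with
    | zero =>
      refine ⟨⟨_, hg0⟩, ?_, ?_, fun x => rfl⟩
      · intro x u hu
        rw [t0] at hu
        have : u = 0 := le_antisymm hu u.2.1
        subst this
        exact hpg (x, 0) (Or.inr (Or.inl rfl))
      · intro x _ u hu
        rw [t0] at hu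
        have : u = 0 := le_antisymm hu u.2.1
        subst this
        rfl
    | succ k ih =>
      obtain ⟨s, s1, s2, s3⟩ := ih
      obtain ⟨T, hT⟩ := ht k
      have hab : t k ≤ t (k + 1) := tm (Nat.le_succ k)
      set b := t (k + 1)
      let f' : C((Fin n → I) × I, B) := ⟨fun w => f (w.1, min w.2 b), by fun_prop⟩
      obtain ⟨G, G1, G2, G3, -⟩ := glue_lift hmicro f' (t k)
        (by
          have : freeze f' (t k) = freeze f (t k) := by
            ext w
            simp only [freeze, f', ContinuousMap.coe_mk, min_eq_left hab]
          rw [this]; exact h2 _)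
        (fun w => g (w.1, min w.2 b))
        (hgA.comp (by fun_prop) fun w hw => hw)
        (fun w hw => hpgA (w.1, min w.2 b) hw)
        s ⟨fun w => loc T (w.1, min w.2 b), by fun_prop⟩
        (by
          intro x u hu
          simp only [f', ContinuousMap.coe_mk, min_eq_left (hu.trans hab)]
          exact s1 x u hu)
        (by
          intro x u hu
          exact hloc2 T x _ (hT ⟨le_min hu hab, min_le_right _ _⟩))
        (by
          intro x hx u hu
          simp only [min_eq_left (hu.trans hab)]
          exact s2 x hx u hu)
        (by
          intro x hx u hu
          exact hloc1 T (x, min u b) hx)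
      refine ⟨G, ?_, ?_, ?_⟩
      · intro x u hu
        have := G1 (x, u)
        simp only [f', ContinuousMap.coe_mk, min_eq_left hu] at this
        exact this
      · intro x hx u hu
        have := G2 (x, u) hx
        simp only [min_eq_left hu] at this
        exact this
      · intro x
        rw [G3, s3]
  obtain ⟨s, s1, s2, s3⟩ := claim m
  rw [hm m le_rfl] at s1 s2
  obtain ⟨G, G1, G2, G3, G4⟩ := glue_lift hmicro f 1 (h2 1) g hgA hpgA s ⟨_, hg1⟩ s1
    (by
      intro x u hu
      have : u = 1 := le_antisymm u.2.2 hu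
      subst this
      exact hpg (x, 1) (Or.inr (Or.inr rfl)))
    s2
    (by
      intro x _ u hu
      have : u = 1 := le_antisymm u.2.2 hu
      subst this
      rfl)
  refine ⟨G, ?_, G1⟩
  rintro ⟨x, u⟩ (hx | hu | hu)
  · exact G2 _ hx
  · simp only at hu
    subst hu
    rw [G3, s3]
  · simp only at hu
    subst hu
    rw [G4]; rfl

end Main

/-! ### Base case: extending maps into weakly contractible spaces -/

theorem base_prod {Y : Type} [TopologicalSpace Y] (hY : WeaklyContractible Y) (n : ℕ)
    (g : (Fin n → I) × I → Y) (hg : ContinuousOn g (bdP n)) :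
    ∃ G : C((Fin n → I) × I, Y), ∀ w ∈ bdP n, G w = g w := by
  classical
  obtain ⟨r, r1, r2⟩ := retr_box n
  have hrb : ∀ w, r w ∈ bdP n := by
    intro w
    rcases r1 w with h | h
    · exact Or.inl h
    · exact Or.inr (Or.inl h)
  let gh : C((Fin n → I) × I, Y) := ⟨fun w => g (r w), hg.comp_continuous r.continuous hrb⟩
  have hgh : ∀ w : (Fin n → I) × I, w.1 ∈ Cube.boundary (Fin n) ∨ w.2 = 0 → gh w = g w := by
    intro w hw
    simp only [gh, ContinuousMap.coe_mk, r2 w hw]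
  let mm : C(I × ((Fin n → I) × I), (Fin n → I) × I) :=
    ⟨fun w => (fun i => w.1 * w.2.1 i, w.1 * w.2.2), by fun_prop⟩
  have mm1 : ∀ w, mm (1, w) = w := by
    intro w
    simp [mm]
  let z0 : (Fin n → I) × I := (fun _ => 0, 0)
  have mm0 : ∀ w, mm (0, w) = z0 := by
    intro w
    simp [mm, z0]
  let y0 := gh z0
  -- deform the top face
  let q0 : (Fin n → I) × I → Y := fun w =>
    if w.2 = 0 then g (w.1, 1) else gh (mm (σ w.2, (w.1, 1)))
  have q0z : ∀ w, w.2 = 0 → q0 w = g (w.1, 1) := fun w hw => if_pos hw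
  have q0A : ∀ w : (Fin n → I) × I, w.1 ∈ Cube.boundary (Fin n) →
      q0 w = gh (mm (σ w.2, (w.1, 1))) := by
    intro w hw
    by_cases h0 : w.2 = 0
    · rw [q0z w h0, h0, unitInterval.symm_zero, mm1, hgh (w.1, 1) (Or.inl hw)]
    · simp only [q0, if_neg h0]
  have hq0 : ContinuousOn q0 {w | w.1 ∈ Cube.boundary (Fin n) ∨ w.2 = 0} := by
    refine ContinuousOn.union_of_isClosed (s := {w : (Fin n → I) × I | w.1 ∈ Cube.boundary (Fin n)})
      (t := {w : (Fin n → I) × I | w.2 = 0}) ?_ ?_ isClosed_A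
      (isClosed_eq continuous_snd continuous_const)
    · have : Continuous fun w : (Fin n → I) × I => gh (mm (σ w.2, (w.1, 1))) := by fun_prop
      exact this.continuousOn.congr fun w hw => q0A w hw
    · have : Continuous fun w : (Fin n → I) × I => g (w.1, 1) :=
        hg.comp_continuous (by fun_prop) fun w => Or.inr (Or.inr rfl)
      exact this.continuousOn.congr fun w hw => q0z w hw
  let q : C((Fin n → I) × I, Y) := ⟨fun w => q0 (r w), hq0.comp_continuous r.continuous r1⟩
  have hq : ∀ w : (Fin n → I) × I, w.1 ∈ Cube.boundary (Fin n) ∨ w.2 = 0 → q w = q0 w := by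
    intro w hw
    simp only [q, ContinuousMap.coe_mk, r2 w hw]
  let l1 : GenLoop (Fin n) Y y0 := ⟨⟨fun x => q (x, 1), by fun_prop⟩, by
    intro x hx
    change q (x, 1) = y0
    rw [hq _ (Or.inl hx), q0A _ hx]
    simp only [unitInterval.symm_one]
    rw [mm0]⟩
  let l0 : GenLoop (Fin n) Y y0 := ⟨ContinuousMap.const _ y0, fun _ _ => rfl⟩
  have hsub := hY.2 n y0
  have hhom : GenLoop.Homotopic l0 l1 := by
    have : (Quotient.mk (GenLoop.Homotopic.setoid (Fin n) y0) l0) =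
      Quotient.mk (GenLoop.Homotopic.setoid (Fin n) y0) l1 := hsub.elim _ _
    exact Quotient.exact this
  obtain ⟨H⟩ := hhom
  have H0 : ∀ x, H (0, x) = y0 := fun x => H.apply_zero x
  have H1 : ∀ x, H (1, x) = q (x, 1) := fun x => H.apply_one x
  have HA : ∀ t, ∀ x ∈ Cube.boundary (Fin n), H (t, x) = y0 := fun t x hx => H.eq_fst t hx
  -- assemble on the open box
  let e := splitCoord (n := n) 0
  let K : (Fin (n + 1) → I) × I → Y := fun w =>
    if w.2 = 0 then H ((e w.1).2, (e w.1).1) else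
      if (e w.1).2 = 1 then q ((e w.1).1, σ w.2) else gh (mm (w.2, e w.1))
  have K0 : ∀ w, w.2 = 0 → K w = H ((e w.1).2, (e w.1).1) := fun w hw => if_pos hw
  have K1 : ∀ w, (e w.1).2 = 1 → K w = q ((e w.1).1, σ w.2) := by
    intro w hw
    by_cases h0 : w.2 = 0
    · rw [K0 w h0, hw, H1, h0, unitInterval.symm_zero]
    · simp only [K, if_neg h0, if_pos hw]
  have KA : ∀ w, (e w.1).1 ∈ Cube.boundary (Fin n) ∨ (e w.1).2 = 0 → K w = gh (mm (w.2, e w.1)) := by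
    intro w hw
    by_cases h0 : w.2 = 0
    · rw [K0 w h0, h0, mm0]
      rcases hw with hw | hw
      · rw [HA _ _ hw]
      · rw [hw, H0]
    by_cases h1 : (e w.1).2 = 1
    · rw [K1 w h1]
      rcases hw with hw | hw
      · rw [hq ((e w.1).1, σ w.2) (Or.inl hw), q0A ((e w.1).1, σ w.2) hw]
        simp only [unitInterval.symm_symm]
        rw [← h1]
      · rw [hw] at h1
        exact absurd h1 zero_ne_one
    · simp only [K, if_neg h0, if_neg h1]
  have he : Continuous e := e.continuous
  have he1 : Continuous fun w : (Fin (n + 1) → I) × I => e w.1 := he.comp continuous_fst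
  have cl1 : IsClosed {w : (Fin (n + 1) → I) × I | (e w.1).2 = 1} :=
    isClosed_eq (continuous_snd.comp he1) continuous_const
  have clA : IsClosed {w : (Fin (n + 1) → I) × I |
      (e w.1).1 ∈ Cube.boundary (Fin n) ∨ (e w.1).2 = 0} :=
    ((isClosed_bd n).preimage (continuous_fst.comp he1)).union
      (isClosed_eq (continuous_snd.comp he1) continuous_const)
  have cl0 : IsClosed {w : (Fin (n + 1) → I) × I | w.2 = 0} :=
    isClosed_eq continuous_snd continuous_const
  have hK : ContinuousOn K {w | w.1 ∈ Cube.boundary (Fin (n + 1)) ∨ w.2 = 0} := by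
    have big : ContinuousOn K ({w | w.2 = 0} ∪ ({w | (e w.1).2 = 1} ∪
        {w | (e w.1).1 ∈ Cube.boundary (Fin n) ∨ (e w.1).2 = 0})) := by
      refine ContinuousOn.union_of_isClosed ?_ (ContinuousOn.union_of_isClosed ?_ ?_ cl1 clA) cl0
        (cl1.union clA)
      · have : Continuous fun w : (Fin (n + 1) → I) × I => H ((e w.1).2, (e w.1).1) :=
          H.continuous.comp ((continuous_snd.comp he1).prodMk (continuous_fst.comp he1))
        exact this.continuousOn.congr fun w hw => K0 w hw
      · have : Continuous fun w : (Fin (n + 1) → I) × I => q ((e w.1).1, σ w.2) :=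
          q.continuous.comp ((continuous_fst.comp he1).prodMk
            (unitInterval.continuous_symm.comp continuous_snd))
        exact this.continuousOn.congr fun w hw => K1 w hw
      · have : Continuous fun w : (Fin (n + 1) → I) × I => gh (mm (w.2, e w.1)) :=
          gh.continuous.comp (mm.continuous.comp (continuous_snd.prodMk he1))
        exact this.continuousOn.congr fun w hw => KA w hw
    refine big.mono ?_
    rintro w (hw | hw)
    · rw [splitCoord_bd 0] at hw
      rcases hw with hw | hw | hw
      · exact Or.inr (Or.inr (Or.inl hw))
      · exact Or.inr (Or.inr (Or.inr hw))
      · exact Or.inr (Or.inl hw)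
    · exact Or.inl hw
  obtain ⟨r', s1, s2⟩ := retr_box (n + 1)
  have hKr : Continuous fun w => K (r' w) := hK.comp_continuous r'.continuous s1
  refine ⟨⟨fun w => K (r' (e.symm w, 1)), hKr.comp
    (e.symm.continuous.prodMk continuous_const)⟩, ?_⟩
  intro w hw
  have hb : e.symm w ∈ Cube.boundary (Fin (n + 1)) := by
    rw [splitCoord_bd 0]
    change e (e.symm w) ∈ bdP n
    rwa [Homeomorph.apply_symm_apply]
  simp only [ContinuousMap.coe_mk]
  rw [s2 _ (Or.inl hb)]
  have hL : w.1 ∈ Cube.boundary (Fin n) ∨ w.2 = 0 → K (e.symm w, 1) = g w := by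
    intro h
    rw [KA _ (by simpa only [Homeomorph.apply_symm_apply] using h)]
    simp only [Homeomorph.apply_symm_apply]
    rw [mm1, hgh _ h]
  rcases hw with h | h | h
  · exact hL (Or.inl h)
  · exact hL (Or.inr h)
  · rw [K1 _ (by simpa only [Homeomorph.apply_symm_apply] using h)]
    simp only [Homeomorph.apply_symm_apply, unitInterval.symm_one]
    rw [hq _ (Or.inr rfl), q0z _ rfl, ← h]

theorem base_ext {Y : Type} [TopologicalSpace Y] (hY : WeaklyContractible Y) (n : ℕ)
    (g : (Fin n → I) → Y) (hg : ContinuousOn g (Cube.boundary (Fin n))) :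
    ∃ G : C(Fin n → I, Y), ∀ w ∈ Cube.boundary (Fin n), G w = g w := by
  cases n with
  | zero =>
    obtain ⟨y⟩ := hY.1
    exact ⟨ContinuousMap.const _ y, by rintro w ⟨i, -⟩; exact i.elim0⟩
  | succ n =>
    let e := splitCoord (n := n) 0
    obtain ⟨G, hG⟩ := base_prod hY n (fun w => g (e.symm w))
      (hg.comp e.symm.continuous.continuousOn fun w hw => by
        rw [splitCoord_bd 0]
        change e (e.symm w) ∈ bdP n
        rwa [Homeomorph.apply_symm_apply])
    refine ⟨⟨fun z => G (e z), G.continuous.comp e.continuous⟩, ?_⟩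
    intro z hz
    have := hG (e z) ((splitCoord_bd 0 z).1 hz)
    simp only [Homeomorph.symm_apply_apply] at this
    exact this

section Final

variable {E B : Type} [TopologicalSpace E] [TopologicalSpace B] {p : C(E, B)}

theorem solv_const (hfib : ∀ b : B, WeaklyContractible {e : E // p e = b}) (n : ℕ)
    (F : C(Fin n → I, B)) (b : B) (hF : ∀ z, F z = b) : Solv p (Cube.boundary (Fin n)) F := by
  classical
  intro g hg hpg
  obtain ⟨y⟩ := (hfib b).1
  let g' : (Fin n → I) → {e : E // p e = b} := fun z => if h : p (g z) = b then ⟨g z, h⟩ else y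
  have hg' : ∀ z ∈ Cube.boundary (Fin n), (g' z : E) = g z := by
    intro z hz
    have : p (g z) = b := by rw [hpg z hz, hF]
    simp only [g', dif_pos this]
  obtain ⟨G, hG⟩ := base_ext (hfib b) n g' (by
    have hind : Topology.IsInducing (Subtype.val : {e : E // p e = b} → E) := ⟨rfl⟩
    refine hind.continuousOn_iff.2 ?_
    exact hg.congr fun z hz => hg' z hz)
  refine ⟨⟨fun z => (G z : E), by fun_prop⟩, ?_, ?_⟩
  · intro z hz
    simp only [ContinuousMap.coe_mk, hG z hz, hg' z hz]
  · intro z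
    rw [hF]
    exact (G z).2

theorem solv_dep (hmicro : IsSerreMicrofibration p)
    (hfib : ∀ b : B, WeaklyContractible {e : E // p e = b}) (k : ℕ) :
    ∀ (n : ℕ) (S : Finset (Fin n)), S.card ≤ k → ∀ F : C(Fin n → I, B),
      (∀ z z', (∀ i ∈ S, z i = z' i) → F z = F z') → Solv p (Cube.boundary (Fin n)) F := by
  induction k with
  | zero =>
    intro n S hS F hF
    have : S = ∅ := Finset.card_eq_zero.1 (Nat.le_zero.1 hS)
    subst this
    exact solv_const hfib n F (F 0) fun z => hF z 0 (by simp)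
  | succ k ih =>
    intro n S hS F hF
    rcases S.eq_empty_or_nonempty with rfl | ⟨t, ht⟩
    · exact solv_const hfib n F (F 0) fun z => hF z 0 (by simp)
    cases n with
    | zero => exact t.elim0
    | succ n =>
      let e := splitCoord t
      let f : C((Fin n → I) × I, B) := ⟨fun w => F (e.symm w), F.continuous.comp e.symm.continuous⟩
      have hcard : (S.erase t).card ≤ k := by
        rw [Finset.card_erase_of_mem ht]; omega
      have hins : ∀ w, e.symm w = t.insertNth w.2 w.1 := fun w => rfl
      have main : Solv p (bdP n) f := by
        refine solv_step hmicro f ?_ ?_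
        · intro T
          refine ih n (Finset.univ.filter fun j => t.succAbove j ∈ S) ?_ _ ?_
          · refine le_trans (Finset.card_le_card_of_injOn (t := S.erase t) t.succAbove ?_ ?_) hcard
            · intro j hj
              simp only [Finset.coe_filter, Finset.mem_univ, true_and, Set.mem_ofPred_eq] at hj
              simp [hj, Fin.succAbove_ne]
            · exact Fin.succAbove_right_injective.injOn
          · intro z z' hz
            refine hF _ _ ?_
            intro i hi
            rw [hins, hins]
            rcases Fin.eq_self_or_eq_succAbove t i with rfl | ⟨j, rfl⟩
            · simp
            · simpa using hz j (by simpa using hi)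
        · intro T
          have h := ih (n + 1) (S.erase t) hcard
            ⟨fun z => freeze f T (e z), (freeze f T).continuous.comp e.continuous⟩ (by
              intro z z' hz
              refine hF _ _ ?_
              intro i hi
              rw [hins, hins]
              rcases Fin.eq_self_or_eq_succAbove t i with rfl | ⟨j, rfl⟩
              · simp
              · simp only [Fin.insertNth_apply_succAbove]
                exact hz (t.succAbove j) (by simp [hi, Fin.succAbove_ne]))
          exact Solv.congr e (splitCoord_bd t) (fun _ => rfl) h
      refine Solv.congr e.symm ?_ (fun _ => rfl) main
      intro w
      rw [splitCoord_bd t]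
      change _ ↔ e (e.symm w) ∈ bdP n
      rw [Homeomorph.apply_symm_apply]

theorem solv_cube (hmicro : IsSerreMicrofibration p)
    (hfib : ∀ b : B, WeaklyContractible {e : E // p e = b}) (n : ℕ) (F : C(Fin n → I, B)) :
    Solv p (Cube.boundary (Fin n)) F :=
  solv_dep hmicro hfib _ n Finset.univ le_rfl F fun _ _ h =>
    congrArg F (funext fun i => h i (Finset.mem_univ i))

theorem solv_prod (hmicro : IsSerreMicrofibration p)
    (hfib : ∀ b : B, WeaklyContractible {e : E // p e = b}) (n : ℕ)
    (F : C((Fin n → I) × I, B)) : Solv p (bdP n) F :=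
  Solv.congr (splitCoord 0) (splitCoord_bd 0) (fun _ => rfl)
    (solv_cube hmicro hfib (n + 1)
      ⟨fun z => F (splitCoord 0 z), F.continuous.comp (splitCoord 0).continuous⟩)

theorem fibration_of_solv (h : ∀ n (F : C((Fin n → I) × I, B)), Solv p (bdP n) F) :
    IsSerreFibration p := by
  intro k F g hg
  let φx : (Fin k → I) × I → (Fin k → I) := fun w i => cl (2 * (w.1 i : ℝ) - 1 / 2)
  let φt : (Fin k → I) × I → I := fun w =>
    (∏ i, (cl (8 * (w.1 i : ℝ)) * cl (8 * (1 - (w.1 i : ℝ))))) * cl (8 * (1 - (w.2 : ℝ)))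
      * cl (8 * (w.2 : ℝ))
  let ψ : C((Fin k → I) × I, (Fin k → I) × I) :=
    ⟨fun w => (fun i => cl (((w.1 i : ℝ) + 1 / 2) / 2), cl ((w.2 : ℝ) / 8)), by fun_prop⟩
  have hφx : Continuous φx := by fun_prop
  have hφt : Continuous φt := by
    have : Continuous fun w : (Fin k → I) × I =>
        ∏ i, (cl (8 * (w.1 i : ℝ)) * cl (8 * (1 - (w.1 i : ℝ)))) := by
      refine continuous_finsetProd _ fun i _ => ?_
      fun_prop
    fun_prop
  have hb : ∀ w ∈ bdP k, φt w = 0 := by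
    rintro w (⟨i, hi⟩ | hw | hw)
    · have : ∏ i, (cl (8 * (w.1 i : ℝ)) * cl (8 * (1 - (w.1 i : ℝ)))) = 0 := by
        refine Finset.prod_eq_zero (Finset.mem_univ i) ?_
        rcases hi with hi | hi
        · rw [cl_of_le_zero (x := 8 * (w.1 i : ℝ)) (by simp [hi]), zero_mul]
        · rw [cl_of_le_zero (x := 8 * (1 - (w.1 i : ℝ))) (by simp [hi]), mul_zero]
      simp only [φt, this, zero_mul]
    · simp only [φt]
      rw [cl_of_le_zero (x := 8 * (w.2 : ℝ)) (by simp [hw]), mul_zero]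
    · simp only [φt]
      rw [cl_of_le_zero (x := 8 * (1 - (w.2 : ℝ))) (by simp [hw]), mul_zero, zero_mul]
  have ψx : ∀ w i, (((ψ w).1 i : I) : ℝ) = ((w.1 i : ℝ) + 1 / 2) / 2 := by
    intro w i
    have h0 := (w.1 i).2.1
    have h1 := (w.1 i).2.2
    exact congrArg Subtype.val
      (cl_coe ⟨((w.1 i : ℝ) + 1 / 2) / 2, by linarith, by linarith⟩)
  have ψt : ∀ w, (((ψ w).2 : I) : ℝ) = (w.2 : ℝ) / 8 := by
    intro w
    have h0 := w.2.2.1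
    have h1 := w.2.2.2
    exact congrArg Subtype.val (cl_coe ⟨(w.2 : ℝ) / 8, by linarith, by linarith⟩)
  have e1 : ∀ w, φx (ψ w) = w.1 := by
    intro w
    funext i
    refine cl_eq ?_
    rw [ψx]; ring
  have e2 : ∀ w, φt (ψ w) = w.2 := by
    intro w
    simp only [φt]
    rw [Finset.prod_eq_one, cl_of_one_le (x := 8 * (1 - ((ψ w).2 : ℝ))), one_mul, one_mul]
    · refine cl_eq ?_
      rw [ψt]; ring
    · rw [ψt]
      have h1 := w.2.2.2
      linarith
    · intro i _
      have h0 := (w.1 i).2.1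
      have h1 := (w.1 i).2.2
      rw [cl_of_one_le, cl_of_one_le, one_mul] <;> rw [ψx] <;> linarith
  obtain ⟨H, H1, H2⟩ := h k ⟨fun w => F (φx w, φt w), F.continuous.comp (hφx.prodMk hφt)⟩
    (fun w => g (φx w)) (g.continuous.comp hφx).continuousOn (by
      intro w hw
      simp only [ContinuousMap.coe_mk, hb w hw]
      exact hg _)
  refine ⟨H.comp ψ, ?_, ?_⟩
  · intro y
    have hw : ψ (y, 0) ∈ bdP k := by
      refine Or.inr (Or.inl (cl_eq ?_))
      simp
    rw [ContinuousMap.comp_apply, H1 _ hw, e1]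
  · intro z
    rw [ContinuousMap.comp_apply, H2]
    simp only [ContinuousMap.coe_mk, e1, e2]

theorem whe_of_solv (hne : Nonempty B → Nonempty E)
    (h0 : ∀ n (F : C(Fin n → I, B)), Solv p (Cube.boundary (Fin n)) F)
    (h : ∀ n (F : C((Fin n → I) × I, B)), Solv p (bdP n) F) :
    IsWeakHomotopyEquiv p := by
  classical
  refine ⟨hne, fun n x => ⟨?_, ?_⟩⟩
  · intro a b
    refine Quotient.inductionOn₂ a b ?_
    intro a b hab
    have hab' := Quotient.exact hab
    obtain ⟨H⟩ := hab'
    have H0 : ∀ y, H (0, y) = p (a.1 y) := fun y => H.apply_zero y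
    have H1 : ∀ y, H (1, y) = p (b.1 y) := fun y => H.apply_one y
    have HA : ∀ t, ∀ y ∈ Cube.boundary (Fin n), H (t, y) = p x := fun t y hy => by
      rw [H.eq_fst t hy]
      change p (a.1 y) = p x
      rw [a.2 y hy]
    let g : (Fin n → I) × I → E := fun w =>
      if w.2 = 0 then a.1 w.1 else if w.2 = 1 then b.1 w.1 else x
    have g0 : ∀ w, w.2 = 0 → g w = a.1 w.1 := fun w hw => if_pos hw
    have g1 : ∀ w, w.2 = 1 → g w = b.1 w.1 := fun w hw => by
      have : w.2 ≠ 0 := by rw [hw]; exact one_ne_zero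
      simp only [g, if_neg this, if_pos hw]
    have gA : ∀ w : (Fin n → I) × I, w.1 ∈ Cube.boundary (Fin n) → g w = x := by
      intro w hw
      by_cases h0 : w.2 = 0
      · rw [g0 w h0, a.2 _ hw]
      by_cases h1 : w.2 = 1
      · rw [g1 w h1, b.2 _ hw]
      simp only [g, if_neg h0, if_neg h1]
    have hg : ContinuousOn g (bdP n) := by
      have c0 : IsClosed {w : (Fin n → I) × I | w.2 = 0} :=
        isClosed_eq continuous_snd continuous_const
      have c1 : IsClosed {w : (Fin n → I) × I | w.2 = 1} :=
        isClosed_eq continuous_snd continuous_const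
      refine ContinuousOn.union_of_isClosed
        (s := {w : (Fin n → I) × I | w.1 ∈ Cube.boundary (Fin n)})
        (t := {w : (Fin n → I) × I | w.2 = 0} ∪ {w : (Fin n → I) × I | w.2 = 1}) ?_
        (ContinuousOn.union_of_isClosed ?_ ?_ c0 c1) isClosed_A (c0.union c1)
      · exact continuousOn_const.congr fun w hw => gA w hw
      · exact (a.1.continuous.comp continuous_fst).continuousOn.congr fun w hw => g0 w hw
      · exact (b.1.continuous.comp continuous_fst).continuousOn.congr fun w hw => g1 w hw
    obtain ⟨G, G1, G2⟩ := h n ⟨fun w => H (w.2, w.1),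
      H.continuous.comp (continuous_snd.prodMk continuous_fst)⟩ g hg (by
        rintro ⟨y, t⟩ (hw | hw | hw)
        · rw [gA _ hw]; exact (HA _ _ hw).symm
        · simp only at hw; subst hw
          rw [g0 _ rfl]; exact (H0 _).symm
        · simp only at hw; subst hw
          rw [g1 _ rfl]; exact (H1 _).symm)
    refine Quotient.sound ?_
    refine ⟨⟨⟨⟨fun w => G (w.2, w.1), by fun_prop⟩, ?_, ?_⟩, ?_⟩⟩
    · intro y
      exact (G1 (y, 0) (Or.inr (Or.inl rfl))).trans (g0 _ rfl)
    · intro y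
      exact (G1 (y, 1) (Or.inr (Or.inr rfl))).trans (g1 _ rfl)
    · intro t y hy
      exact ((G1 (y, t) (Or.inl hy)).trans (gA _ hy)).trans (a.2 y hy).symm
  · intro b
    refine Quotient.inductionOn b ?_
    intro b
    obtain ⟨G, G1, G2⟩ := h0 n b.1 (fun _ => x) continuousOn_const
      (fun y hy => (b.2 y hy).symm)
    refine ⟨Quotient.mk _ ⟨G, G1⟩, ?_⟩
    refine congrArg (Quotient.mk _) (Subtype.ext (ContinuousMap.ext fun y => ?_))
    exact G2 y

end Final

/-- A Serre microfibration with weakly contractible fibers is a Serre fibration, and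
therefore a weak homotopy equivalence. -/
theorem stmt3 {E B : Type} [TopologicalSpace E] [TopologicalSpace B] (p : C(E, B))
    (hmicro : IsSerreMicrofibration p)
    (hfib : ∀ b : B, WeaklyContractible {e : E // p e = b}) :
    IsSerreFibration p ∧ IsWeakHomotopyEquiv p := by
  refine ⟨fibration_of_solv (solv_prod hmicro hfib),
    whe_of_solv ?_ (solv_cube hmicro hfib) (solv_prod hmicro hfib)⟩
  rintro ⟨b⟩
  obtain ⟨e⟩ := (hfib b).1
  exact ⟨e.1⟩
end
end

section
/- Let Φ_N^N be the scanning space of germs at bounded regions of paths of configurations in ℝ^N, and let U_1 ⊆ Φ_N^N consist of those φ such that for some r > 0 the intersection φ ∩ B(0, r) is a single path through the ball, and U_0 those φ such that φ ∩ B(0, r) is empty for some r > 0. Then U_0 and U_1 are open subsets of Φ_N^N whose union is Φ_N^N, U_0 and U_1 are each weakly contractible, their intersection U_0 ∩ U_1 is weakly equivalent to the sphere S^{N−1}, and consequently Φ_N^N is weakly equivalent to S^N. -/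
open scoped unitInterval Topology.Homotopy

noncomputable section

/-- `ℝ^∞`: the space of finitely supported sequences of reals. -/
def Rinf : Type := {f : ℕ → ℝ // ∃ N, ∀ n, N ≤ n → f n = 0}

instance : TopologicalSpace Rinf := by unfold Rinf; infer_instance

/-- The ordered configuration space of `n` points in `X`. -/
def ConfSp (n : ℕ) (X : Type) [TopologicalSpace X] : Type :=
  {f : Fin n → X // Function.Injective f}

instance (n : ℕ) (X : Type) [TopologicalSpace X] : TopologicalSpace (ConfSp n X) := by
  unfold ConfSp; infer_instance

/-- The relation identifying configurations differing by a permutation of the labels. -/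
def confSetoid (n : ℕ) (X : Type) [TopologicalSpace X] : Setoid (ConfSp n X) where
  r f g := ∃ e : Equiv.Perm (Fin n), f.1 ∘ e = g.1
  iseqv := by
    refine ⟨fun f => ⟨1, ?_⟩, ?_, ?_⟩
    · ext i; rfl
    · rintro f g ⟨e, h⟩
      exact ⟨e.symm, by rw [← h]; ext i; simp⟩
    · rintro f g h ⟨e, h1⟩ ⟨t2, h2⟩
      exact ⟨t2.trans e , by rw [← h2, ← h1]; rfl⟩

/-- The unordered configuration space of `n` points in `X`. -/
def UConfSp (n : ℕ) (X : Type) [TopologicalSpace X] : Type :=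
  Quotient (confSetoid n X)

instance (n : ℕ) (X : Type) [TopologicalSpace X] : TopologicalSpace (UConfSp n X) := by
  unfold UConfSp; infer_instance


/-- The space `⊔ₙ Ψₙ(ℝ × ℝ^N)` of graphs of paths of finite configurations in `ℝ^N`:
a path `φ(t) = (t, z(t))` is recorded by its number of points `n` and the path `z`. -/
def PathsF (N : ℕ) : Type := Σ n : ℕ, C(ℝ, UConfSp n (Fin N → ℝ))

instance (N : ℕ) : TopologicalSpace (PathsF N) := by unfold PathsF; infer_instance

/-- Membership of a point in an unordered configuration. -/
def memConf {n : ℕ} {X : Type} [TopologicalSpace X] (x : X) (c : UConfSp n X) : Prop :=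
  ∃ f : ConfSp n X, Quotient.mk (confSetoid n X) f = c ∧ ∃ i, f.1 i = x

/-- The image (trace) of a path of configurations, as a subset of `ℝ × ℝ^N`. -/
def traceOf (N : ℕ) (q : PathsF N) : Set (ℝ × (Fin N → ℝ)) :=
  {p | memConf p.2 (q.2 p.1)}

/-- The box `[-R/2, R/2] × B_R(0) ⊆ ℝ × ℝ^N`. -/
def boxSet (N : ℕ) (R : ℕ) : Set (ℝ × (Fin N → ℝ)) :=
  {p | |p.1| ≤ (R : ℝ) / 2 ∧ ∀ i, |p.2 i| ≤ (R : ℝ) / 2}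

/-- Two paths of configurations are identified at stage `R` if their images agree on
the box of size `R`. -/
def germSetoid (N R : ℕ) : Setoid (PathsF N) where
  r q q' := traceOf N q ∩ boxSet N R = traceOf N q' ∩ boxSet N R
  iseqv := ⟨fun _ => rfl, Eq.symm, Eq.trans⟩

/-- The stage-`R` space of germs. -/
def PhiR (N R : ℕ) : Type := Quotient (germSetoid N R)

instance (N R : ℕ) : TopologicalSpace (PhiR N R) := by unfold PhiR; infer_instance

lemma boxSet_mono (N R : ℕ) : boxSet N R ⊆ boxSet N (R + 1) := by
  rintro p ⟨h1, h2⟩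
  constructor
  · refine le_trans h1 ?_
    push_cast
    linarith
  · intro i
    refine le_trans (h2 i) ?_
    push_cast
    linarith

/-- The restriction map from stage `R+1` to stage `R`. -/
def resPhi (N R : ℕ) : PhiR N (R + 1) → PhiR N R :=
  Quotient.map' id (by
    intro q q' h
    have h' : traceOf N q ∩ boxSet N (R + 1) = traceOf N q' ∩ boxSet N (R + 1) := h
    have key : ∀ s : Set (ℝ × (Fin N → ℝ)),
        s ∩ boxSet N R = (s ∩ boxSet N (R + 1)) ∩ boxSet N R := fun s => by
      rw [Set.inter_assoc, Set.inter_eq_self_of_subset_right (boxSet_mono N R)]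
    show traceOf N q ∩ boxSet N R = traceOf N q' ∩ boxSet N R
    rw [key, h', ← key])

/-- The scanning space `Φ_N^N`: the inverse limit over `R` of the stage-`R` spaces of
germs of paths of configurations. -/
def PhiInf (N : ℕ) : Type :=
  {u : ∀ R : ℕ, PhiR N R // ∀ R, resPhi N R (u (R + 1)) = u R}

instance (N : ℕ) : TopologicalSpace (PhiInf N) := by unfold PhiInf; infer_instance

/-- The trace of a stage-`R` germ (well defined on the box of size `R`). -/
def traceR (N R : ℕ) : PhiR N R → Set (ℝ × (Fin N → ℝ)) :=
  Quotient.lift (fun q => traceOf N q ∩ boxSet N R) (fun _ _ h => h)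

/-- The local image of an element of `Φ_N^N`. -/
def traceU (N : ℕ) (u : PhiInf N) : Set (ℝ × (Fin N → ℝ)) :=
  ⋃ R, traceR N R (u.1 R)

/-- `U₀ ⊆ Φ_N^N`: germs whose image misses a ball around the origin. -/
def U0set (N : ℕ) : Set (PhiInf N) :=
  {u | ∃ r > (0 : ℝ), traceU N u ∩ Metric.ball (0 : ℝ × (Fin N → ℝ)) r = ∅}

/-- `U₁ ⊆ Φ_N^N`: germs whose image is, inside a ball around the origin, the graph of a
single path passing through the ball. -/
def U1set (N : ℕ) : Set (PhiInf N) :=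
  {u | ∃ r > (0 : ℝ), ∃ g : C(ℝ, Fin N → ℝ),
    (0, g 0) ∈ Metric.ball (0 : ℝ × (Fin N → ℝ)) r ∧
      traceU N u ∩ Metric.ball (0 : ℝ × (Fin N → ℝ)) r =
        {p : ℝ × (Fin N → ℝ) | p.2 = g p.1} ∩ Metric.ball (0 : ℝ × (Fin N → ℝ)) r}

/-! ### Homotopy groups and free homotopies -/

section HG

/-- Sup-norm distance from the centre of the cube (normalised to be `1` on the boundary). -/
def cubeM {n : ℕ} (y : Fin n → I) : ℝ := ‖fun i => 2 * (y i : ℝ) - 1‖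

/-- Stretch the cube about its centre by the factor `1 + s`, clamping to the cube. -/
def cubeSt {n : ℕ} (s : ℝ) (y : Fin n → I) : Fin n → I := fun i =>
  Set.projIcc (0 : ℝ) 1 zero_le_one (1 / 2 + (1 + s) * ((y i : ℝ) - 1 / 2))

lemma continuous_cubeM {n : ℕ} : Continuous (cubeM (n := n)) := by
  unfold cubeM; fun_prop

lemma continuous_cubeSt {n : ℕ} : Continuous (fun p : ℝ × (Fin n → I) => cubeSt p.1 p.2) := by
  unfold cubeSt
  refine continuous_pi fun i => continuous_projIcc.comp ?_
  fun_prop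

lemma cubeSt_zero {n : ℕ} (y : Fin n → I) : cubeSt 0 y = y := by
  funext i
  unfold cubeSt
  have : (1 / 2 + (1 + 0) * ((y i : ℝ) - 1 / 2)) = (y i : ℝ) := by ring
  rw [this, Set.projIcc_val]

lemma cubeSt_mem {n : ℕ} {s : ℝ} (hs : 0 ≤ s) {y : Fin n → I} (h : 1 ≤ (1 + s) * cubeM y) :
    cubeSt s y ∈ Cube.boundary (Fin n) := by
  by_contra hc
  have h1 : ∀ i, ‖2 * (y i : ℝ) - 1‖ < 1 / (1 + s) := by
    intro i
    by_contra hi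
    push Not at hi
    rw [div_le_iff₀ (by linarith), Real.norm_eq_abs] at hi
    apply hc
    refine ⟨i, ?_⟩
    unfold cubeSt
    rcases le_total 0 (2 * (y i : ℝ) - 1) with h0 | h0
    · right
      rw [abs_of_nonneg h0] at hi
      exact Set.projIcc_of_right_le _ (by nlinarith)
    · left
      rw [abs_of_nonpos h0] at hi
      exact Set.projIcc_of_le_left _ (by nlinarith)
  have h2 : cubeM y < 1 / (1 + s) := by
    unfold cubeM
    rw [pi_norm_lt_iff (by positivity)]
    exact h1
  rw [lt_div_iff₀ (by linarith)] at h2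
  linarith

lemma cubeM_boundary {n : ℕ} {y : Fin n → I} (h : y ∈ Cube.boundary (Fin n)) : cubeM y = 1 := by
  apply le_antisymm
  · unfold cubeM
    rw [pi_norm_le_iff_of_nonneg zero_le_one]
    intro i
    rw [Real.norm_eq_abs, abs_le]
    have h0 := (y i).2.1
    have h1 := (y i).2.2
    constructor <;> linarith
  · obtain ⟨i, hi⟩ := h
    have h1 := norm_le_pi_norm (fun i => 2 * (y i : ℝ) - 1) i
    have h2 : ‖2 * (y i : ℝ) - 1‖ = 1 := by
      rcases hi with hi | hi <;> rw [hi] <;> norm_num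
    unfold cubeM
    linarith

variable {X : Type} [TopologicalSpace X]

/-- Gluing a map on the inner cube with a path on the collar. -/
lemma continuous_glue {n : ℕ} {Z : Type*} [TopologicalSpace Z] {x x' : X} (γ : Path x x')
    (f : Z × (Fin n → I) → X) (hf : Continuous f)
    (hb : ∀ z, ∀ y ∈ Cube.boundary (Fin n), f (z, y) = x)
    (s : Z → I) (hs : Continuous s) :
    Continuous (fun p : Z × (Fin n → I) =>
      if (1 + (s p.1 : ℝ)) * cubeM p.2 ≤ 1 then f (p.1, cubeSt (s p.1) p.2)
      else γ (Set.projIcc (0 : ℝ) 1 zero_le_one ((1 + (s p.1 : ℝ)) * cubeM p.2 - 1))) := by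
  have hm := continuous_cubeM (n := n)
  refine Continuous.if_le ?_ ?_ (by fun_prop) (by fun_prop) ?_
  · refine hf.comp (continuous_fst.prodMk ?_)
    exact continuous_cubeSt.comp
      ((continuous_subtype_val.comp (hs.comp continuous_fst)).prodMk continuous_snd)
  · exact γ.continuous.comp (continuous_projIcc.comp (by fun_prop))
  · intro p hp
    rw [hb _ _ (cubeSt_mem (s p.1).2.1 hp.ge), hp, Set.projIcc_of_le_left _ (by simp)]
    exact γ.source.symm

/-- A free homotopy between loops, moving the base point along `γ`. -/
def Along {n : ℕ} {x x' : X} (γ : Path x x') (p : GenLoop (Fin n) X x)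
    (p' : GenLoop (Fin n) X x') : Prop :=
  ∃ H : C(I × (Fin n → I), X), (∀ y, H (0, y) = p y) ∧ (∀ y, H (1, y) = p' y) ∧
    ∀ s, ∀ y ∈ Cube.boundary (Fin n), H (s, y) = γ s

lemma Along.symm {n : ℕ} {x x' : X} {γ : Path x x'} {p : GenLoop (Fin n) X x}
    {p' : GenLoop (Fin n) X x'} (h : Along γ p p') : Along γ.symm p' p := by
  obtain ⟨H, h0, h1, hb⟩ := h
  refine ⟨⟨fun q => H (unitInterval.symm q.1, q.2), by fun_prop⟩, ?_, ?_, ?_⟩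
  · intro y; simpa using h1 y
  · intro y; simpa using h0 y
  · intro s y hy; simpa using hb (unitInterval.symm s) y hy

/-- Transport of a loop along a path. -/
def transp {n : ℕ} {x x' : X} (γ : Path x x') (p : GenLoop (Fin n) X x) :
    GenLoop (Fin n) X x' :=
  ⟨⟨fun y => if (1 + ((1 : I) : ℝ)) * cubeM y ≤ 1 then p (cubeSt ((1 : I) : ℝ) y)
      else γ (Set.projIcc (0 : ℝ) 1 zero_le_one ((1 + ((1 : I) : ℝ)) * cubeM y - 1)),
    (continuous_glue γ (fun q : Unit × (Fin n → I) => p q.2)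
      (p.1.continuous.comp continuous_snd) (fun _ y hy => p.2 y hy) (fun _ => 1)
      continuous_const).comp (continuous_const.prodMk continuous_id : Continuous
        (fun y : Fin n → I => (((), y) : Unit × (Fin n → I))))⟩, by
    intro y hy
    simp only [ContinuousMap.coe_mk, cubeM_boundary hy]
    norm_num⟩

lemma along_transp {n : ℕ} {x x' : X} (γ : Path x x') (p : GenLoop (Fin n) X x) :
    Along γ p (transp γ p) := by
  refine ⟨⟨_, continuous_glue γ (fun q : I × (Fin n → I) => p q.2)
      (p.1.continuous.comp continuous_snd) (fun _ y hy => p.2 y hy) (fun s => s)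
      continuous_id⟩, ?_, ?_, ?_⟩
  · intro y
    have hy : cubeM y ≤ 1 := by
      unfold cubeM
      rw [pi_norm_le_iff_of_nonneg zero_le_one]
      intro i
      rw [Real.norm_eq_abs, abs_le]
      have h0 := (y i).2.1
      have h1 := (y i).2.2
      constructor <;> linarith
    simp [hy, cubeSt_zero]
  · intro y
    rfl
  · intro s y hy
    simp only [ContinuousMap.coe_mk, cubeM_boundary hy, mul_one]
    split_ifs with h
    · have hs : s = 0 := by
        apply Subtype.ext
        have := s.2.1
        have h' : (s : ℝ) ≤ 0 := by linarith
        exact le_antisymm h' this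
      subst hs
      simp only [Set.Icc.coe_zero, cubeSt_zero]
      rw [γ.source]
      exact p.2 y hy
    · rw [add_sub_cancel_left, Set.projIcc_val]

lemma transp_congr {n : ℕ} {x x' : X} (γ : Path x x') {p q : GenLoop (Fin n) X x}
    (h : GenLoop.Homotopic p q) : GenLoop.Homotopic (transp γ p) (transp γ q) := by
  obtain ⟨F⟩ := h
  have hF : ∀ z, ∀ y ∈ Cube.boundary (Fin n), F (z, y) = x := by
    intro z y hy
    rw [F.eq_fst z hy]
    exact p.2 y hy
  refine ⟨⟨⟨⟨_, continuous_glue γ F F.continuous hF (fun _ => 1) continuous_const⟩, ?_, ?_⟩, ?_⟩⟩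
  · intro y
    simp [transp]
  · intro y
    simp [transp]
  · intro s y hy
    simp only [transp, ContinuousMap.coe_mk, cubeM_boundary hy]
    norm_num

/-- The end of a free homotopy along `γ` is homotopic to the transport of its start. -/
lemma Along.homotopic {n : ℕ} {x x' : X} {γ : Path x x'} {p : GenLoop (Fin n) X x}
    {p' : GenLoop (Fin n) X x'} (h : Along γ p p') : GenLoop.Homotopic p' (transp γ p) := by
  obtain ⟨H, h0, h1, hb⟩ := h
  have hm := continuous_cubeM (n := n)
  have hc : Continuous (fun q : I × (Fin n → I) =>
      H (Set.projIcc (0 : ℝ) 1 zero_le_one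
        (1 - (q.1 : ℝ) + max 0 ((1 + (q.1 : ℝ)) * cubeM q.2 - 1)), cubeSt q.1 q.2)) := by
    refine H.continuous.comp (Continuous.prodMk ?_ ?_)
    · exact continuous_projIcc.comp (by fun_prop)
    · exact continuous_cubeSt.comp
        ((continuous_subtype_val.comp continuous_fst).prodMk continuous_snd)
  have hle : ∀ y : Fin n → I, cubeM y ≤ 1 := by
    intro y
    unfold cubeM
    rw [pi_norm_le_iff_of_nonneg zero_le_one]
    intro i
    rw [Real.norm_eq_abs, abs_le]
    have h0 := (y i).2.1
    have h1 := (y i).2.2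
    constructor <;> linarith
  refine ⟨⟨⟨⟨_, hc⟩, ?_, ?_⟩, ?_⟩⟩
  · intro y
    have e : max 0 (cubeM y - 1) = 0 := max_eq_left (by linarith [hle y])
    simp [cubeSt_zero, e]
    exact h1 y
  · intro y
    simp only [Set.Icc.coe_one, sub_self, zero_add]
    change _ = if (1 + ((1 : I) : ℝ)) * cubeM y ≤ 1 then p (cubeSt ((1 : I) : ℝ) y)
      else γ (Set.projIcc (0 : ℝ) 1 zero_le_one ((1 + ((1 : I) : ℝ)) * cubeM y - 1))
    simp only [Set.Icc.coe_one]
    split_ifs with h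
    · rw [max_eq_left (by linarith), Set.projIcc_of_le_left _ le_rfl]
      exact h0 _
    · push Not at h
      rw [max_eq_right (by linarith)]
      exact hb _ _ (cubeSt_mem zero_le_one h.le)
  · intro s y hy
    have hs := s.2.1
    simp only [ContinuousMap.coe_mk, cubeM_boundary hy, mul_one, add_sub_cancel_left]
    rw [max_eq_right hs, sub_add_cancel, Set.projIcc_of_right_le _ le_rfl]
    rw [hb _ _ (cubeSt_mem hs (by rw [cubeM_boundary hy]; linarith))]
    exact γ.target.trans (p'.2 y hy).symm

lemma Along.unique {n : ℕ} {x x' : X} {γ : Path x x'} {p q : GenLoop (Fin n) X x}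
    {p' q' : GenLoop (Fin n) X x'} (h : Along γ p p') (h' : Along γ q q')
    (hpq : GenLoop.Homotopic p q) : GenLoop.Homotopic p' q' :=
  (h.homotopic.trans (transp_congr γ hpq)).trans h'.homotopic.symm

/-- The image of a loop. -/
def loopMap {n : ℕ} {Y : Type} [TopologicalSpace Y] (f : C(X, Y)) {x : X}
    (p : GenLoop (Fin n) X x) : GenLoop (Fin n) Y (f x) :=
  ⟨f.comp p.1, fun y hy => by
        simp only [ContinuousMap.comp_apply]
        rw [p.2 y hy]⟩

lemma homotopyGroupMap_mk {n : ℕ} {Y : Type} [TopologicalSpace Y] (f : C(X, Y)) {x : X}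
    (p : GenLoop (Fin n) X x) :
    homotopyGroupMap (Fin n) f x (Quotient.mk _ p) = Quotient.mk _ (loopMap f p) := rfl

lemma bijective_of_homotopic_id (k : C(X, X)) (h : ContinuousMap.Homotopic (ContinuousMap.id X) k)
    (n : ℕ) (x : X) : Function.Bijective (homotopyGroupMap (Fin n) k x) := by
  obtain ⟨H⟩ := h
  let γ : Path x (k x) := ⟨⟨fun s => H (s, x), by fun_prop⟩, by simp, by simp⟩
  have key : ∀ p : GenLoop (Fin n) X x, Along γ p (loopMap k p) := by
    intro p
    have hp : Continuous p := p.1.continuous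
    refine ⟨⟨fun q => H (q.1, p q.2), by fun_prop⟩, ?_, ?_, ?_⟩
    · intro y; simp
    · intro y
      simp
      rfl
    · intro s y hy
      have : p y = x := p.2 y hy
      simp only [ContinuousMap.coe_mk, this]
      rfl
  constructor
  · intro a b
    induction a using Quotient.inductionOn with | _ p
    induction b using Quotient.inductionOn with | _ q
    intro hab
    rw [homotopyGroupMap_mk, homotopyGroupMap_mk] at hab
    exact Quotient.sound ((key p).symm.unique (key q).symm (Quotient.exact hab))
  · intro b
    induction b using Quotient.inductionOn with | _ q
    refine ⟨Quotient.mk _ (transp γ.symm q), ?_⟩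
    rw [homotopyGroupMap_mk]
    apply Quotient.sound
    have h1 := (along_transp γ.symm q).symm
    rw [Path.symm_symm] at h1
    exact (key _).unique h1 (GenLoop.Homotopic.refl _)

lemma homotopyGroupMap_comp {Y Z : Type} [TopologicalSpace Y] [TopologicalSpace Z]
    (f : C(X, Y)) (g : C(Y, Z)) (n : ℕ) (x : X) :
    homotopyGroupMap (Fin n) (g.comp f) x =
      homotopyGroupMap (Fin n) g (f x) ∘ homotopyGroupMap (Fin n) f x := by
  funext a
  induction a using Quotient.inductionOn with | _ p
  rfl

lemma isWeak_of_homotopyEquiv {Y : Type} [TopologicalSpace Y]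
    (e : ContinuousMap.HomotopyEquiv X Y) : IsWeakHomotopyEquiv e.toFun := by
  refine ⟨fun ⟨y⟩ => ⟨e.invFun y⟩, fun n x => ?_⟩
  have h1 := fun x => bijective_of_homotopic_id _ e.left_inv.symm n x
  have h2 := fun x => bijective_of_homotopic_id _ e.right_inv.symm n x
  have a1 := h1 x
  have a2 := h2 (e.toFun x)
  rw [homotopyGroupMap_comp] at a1 a2
  have hg : Function.Bijective (homotopyGroupMap (Fin n) e.invFun (e.toFun x)) :=
    ⟨a2.injective.of_comp, a1.surjective.of_comp⟩
  exact (Function.Bijective.of_comp_iff' hg _).1 a1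

lemma isWeak_id : IsWeakHomotopyEquiv (ContinuousMap.id X) :=
  isWeak_of_homotopyEquiv (ContinuousMap.HomotopyEquiv.refl X)

lemma weaklyEquivalent_of_homotopyEquiv {Y : Type} [TopologicalSpace Y]
    (e : ContinuousMap.HomotopyEquiv X Y) : WeaklyEquivalent X Y :=
  ⟨X, inferInstance, ContinuousMap.id X, e.toFun, isWeak_id, isWeak_of_homotopyEquiv e⟩

lemma weaklyContractible_of_contractible [ContractibleSpace X] : WeaklyContractible X := by
  refine ⟨inferInstance, fun n x => ⟨?_⟩⟩
  obtain ⟨c, hc⟩ := (id_nullhomotopic X)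
  have h1 := (bijective_of_homotopic_id _ hc n x).injective
  intro a b
  apply h1
  induction a using Quotient.inductionOn with | _ p
  induction b using Quotient.inductionOn with | _ q
  rw [homotopyGroupMap_mk, homotopyGroupMap_mk]
  congr 1

/-- A strong deformation retraction onto the image of an embedding. -/
def defRet {Y : Type} [TopologicalSpace Y] (j : C(Y, X)) (hj : Topology.IsEmbedding j)
    (H : C(I × X, X)) (h0 : ∀ x, H (0, x) = x) (h1 : ∀ x, ∃ y, j y = H (1, x))
    (hfix : ∀ y, H (1, j y) = j y) : ContinuousMap.HomotopyEquiv X Y where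
  toFun := ⟨fun x => (h1 x).choose, by
    rw [hj.continuous_iff]
    have : (j ∘ fun x => (h1 x).choose) = fun x => H (1, x) := by
      funext x
      exact (h1 x).choose_spec
    rw [this]
    fun_prop⟩
  invFun := j
  left_inv := by
    symm
    refine ⟨⟨H, h0, fun x => ?_⟩⟩
    exact (h1 x).choose_spec.symm
  right_inv := by
    have : ContinuousMap.comp ⟨fun x => (h1 x).choose, by
        rw [hj.continuous_iff]
        have : (j ∘ fun x => (h1 x).choose) = fun x => H (1, x) := by
          funext x
          exact (h1 x).choose_spec
        rw [this]
        fun_prop⟩ j = ContinuousMap.id Y := by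
      ext y
      apply hj.injective
      exact (h1 (j y)).choose_spec.trans (hfix y)
    rw [this]

end HG

/-! ### The topology of configuration spaces and of the scanning space -/

section Conf

variable {n : ℕ} {X : Type} [TopologicalSpace X]

/-- The class of an ordered configuration. -/
def mkC (f : ConfSp n X) : UConfSp n X := Quotient.mk (confSetoid n X) f

lemma mkC_surj (c : UConfSp n X) : ∃ f, mkC f = c := Quotient.exists_rep c

lemma memConf_mkC (x : X) (f : ConfSp n X) : memConf x (mkC f) ↔ ∃ i, f.1 i = x := by
  constructor
  · rintro ⟨g, hg, i, hi⟩
    obtain ⟨e, he⟩ := Quotient.exact hg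
    refine ⟨e.symm i, ?_⟩
    rw [← he]
    simpa using hi
  · rintro ⟨i, hi⟩
    exact ⟨f, rfl, i, hi⟩

lemma continuous_mkC : Continuous (mkC (n := n) (X := X)) := continuous_quot_mk

/-- Permutation of configurations. -/
def permConf (e : Equiv.Perm (Fin n)) (f : ConfSp n X) : ConfSp n X :=
  ⟨f.1 ∘ e, f.2.comp e.injective⟩

lemma continuous_confVal : Continuous (fun f : ConfSp n X => f.1) := continuous_subtype_val

lemma continuous_confVal_apply (i : Fin n) : Continuous (fun f : ConfSp n X => f.1 i) :=
  (continuous_apply i).comp continuous_confVal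

lemma continuous_permConf (e : Equiv.Perm (Fin n)) :
    Continuous (permConf e : ConfSp n X → ConfSp n X) := by
  refine Continuous.subtype_mk ?_ _
  exact continuous_pi fun i => continuous_confVal_apply (e i)

lemma isOpenQuotientMap_mkC : IsOpenQuotientMap (mkC (n := n) (X := X)) := by
  refine ⟨mkC_surj, continuous_mkC, ?_⟩
  intro U hU
  have : IsOpen (mkC ⁻¹' (mkC '' U)) := by
    have e : mkC ⁻¹' (mkC '' U) = ⋃ e : Equiv.Perm (Fin n), permConf e ⁻¹' U := by
      ext f
      simp only [Set.mem_preimage, Set.mem_image, Set.mem_iUnion]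
      constructor
      · rintro ⟨g, hg, h⟩
        obtain ⟨e, he⟩ := Quotient.exact h.symm
        refine ⟨e, ?_⟩
        have : permConf e f = g := Subtype.ext he
        rw [this]; exact hg
      · rintro ⟨e, he⟩
        refine ⟨_, he, Quotient.sound ⟨e.symm, ?_⟩⟩
        ext i; simp [permConf]
    rw [e]
    exact isOpen_iUnion fun e => hU.preimage (continuous_permConf e)
  exact this

/-- Push forward of configurations by an injective map. -/
def cmap (φ : X → X) (hφ : Function.Injective φ) : UConfSp n X → UConfSp n X :=
  Quotient.map (fun f : ConfSp n X => (⟨φ ∘ f.1, hφ.comp f.2⟩ : ConfSp n X)) (by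
    rintro f g ⟨e, he⟩
    exact ⟨e, congrArg (fun g => φ ∘ g) he⟩)

lemma memConf_cmap (φ : X → X) (hφ : Function.Injective φ) (c : UConfSp n X) (y : X) :
    memConf y (cmap φ hφ c) ↔ ∃ x, memConf x c ∧ φ x = y := by
  obtain ⟨f, rfl⟩ := mkC_surj c
  refine (memConf_mkC y (⟨φ ∘ f.1, hφ.comp f.2⟩ : ConfSp n X)).trans ?_
  constructor
  · rintro ⟨i, hi⟩
    exact ⟨f.1 i, (memConf_mkC _ _).2 ⟨i, rfl⟩, hi⟩
  · rintro ⟨x, hx, rfl⟩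
    obtain ⟨i, rfl⟩ := (memConf_mkC _ _).1 hx
    exact ⟨i, rfl⟩

lemma continuous_cmap {T : Type} [TopologicalSpace T] (F : T → X → X)
    (hF : ∀ a, Function.Injective (F a)) (hc : Continuous (fun p : T × X => F p.1 p.2)) :
    Continuous (fun p : UConfSp n X × T => cmap (F p.2) (hF p.2) p.1) := by
  have hq : IsOpenQuotientMap (Prod.map (mkC (n := n) (X := X)) (id : T → T)) :=
    isOpenQuotientMap_mkC.prodMap IsOpenQuotientMap.id
  rw [hq.isQuotientMap.continuous_iff]
  change Continuous (fun p : ConfSp n X × T =>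
    mkC (⟨F p.2 ∘ p.1.1, (hF p.2).comp p.1.2⟩ : ConfSp n X))
  refine continuous_mkC.comp (Continuous.subtype_mk ?_ _)
  refine continuous_pi fun i => ?_
  exact hc.comp (continuous_snd.prodMk ((continuous_confVal_apply i).comp continuous_fst))

lemma isOpen_conf {T : Type} [TopologicalSpace T] (P : T → UConfSp n X → Prop)
    (h : IsOpen {p : T × ConfSp n X | P p.1 (mkC p.2)}) :
    IsOpen {p : T × UConfSp n X | P p.1 p.2} := by
  have hq : IsOpenQuotientMap (Prod.map (id : T → T) (mkC (n := n) (X := X))) :=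
    IsOpenQuotientMap.id.prodMap isOpenQuotientMap_mkC
  rw [← hq.isQuotientMap.isOpen_preimage]
  exact h

end Conf

section Phi

variable {N : ℕ}

lemma mem_boxSet (R : ℕ) (p : ℝ × (Fin N → ℝ)) :
    p ∈ boxSet N R ↔ |p.1| ≤ (R : ℝ) / 2 ∧ ‖p.2‖ ≤ (R : ℝ) / 2 := by
  unfold boxSet
  rw [pi_norm_le_iff_of_nonneg (by positivity)]
  rfl

/-- The class of a path of configurations at stage `R`. -/
def mkR (R : ℕ) (q : PathsF N) : PhiR N R := Quotient.mk (germSetoid N R) q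

lemma mkR_surj (R : ℕ) (w : PhiR N R) : ∃ q, mkR R q = w := Quotient.exists_rep w

lemma mkR_eq {R : ℕ} {q q' : PathsF N} :
    mkR R q = mkR R q' ↔ traceOf N q ∩ boxSet N R = traceOf N q' ∩ boxSet N R :=
  ⟨fun h => Quotient.exact h, fun h => Quotient.sound h⟩

lemma isQuotientMap_mkR (R : ℕ) : Topology.IsQuotientMap (mkR (N := N) R) := isQuotientMap_quot_mk

lemma continuous_mkR (R : ℕ) : Continuous (mkR (N := N) R) := (isQuotientMap_mkR R).continuous

lemma traceR_mkR (R : ℕ) (q : PathsF N) : traceR N R (mkR R q) = traceOf N q ∩ boxSet N R := rfl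

lemma traceR_inj {R : ℕ} {w w' : PhiR N R} (h : traceR N R w = traceR N R w') : w = w' := by
  obtain ⟨q, rfl⟩ := mkR_surj R w
  obtain ⟨q', rfl⟩ := mkR_surj R w'
  exact mkR_eq.2 h

lemma traceR_res (R : ℕ) (w : PhiR N (R + 1)) :
    traceR N R (resPhi N R w) = traceR N (R + 1) w ∩ boxSet N R := by
  obtain ⟨q, rfl⟩ := mkR_surj _ w
  change traceOf N q ∩ boxSet N R = traceOf N q ∩ boxSet N (R + 1) ∩ boxSet N R
  rw [Set.inter_assoc, Set.inter_eq_self_of_subset_right (boxSet_mono N R)]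

lemma traceR_step (u : PhiInf N) (R : ℕ) :
    traceR N R (u.1 R) = traceR N (R + 1) (u.1 (R + 1)) ∩ boxSet N R := by
  rw [← u.2 R, traceR_res]

lemma boxSet_mono_le {R S : ℕ} (h : R ≤ S) : boxSet N R ⊆ boxSet N S :=
  monotone_nat_of_le_succ (fun R => boxSet_mono N R) h

lemma traceR_le (u : PhiInf N) {R S : ℕ} (h : R ≤ S) :
    traceR N R (u.1 R) = traceR N S (u.1 S) ∩ boxSet N R := by
  induction S, h using Nat.le_induction with
  | base =>
    obtain ⟨q, hq⟩ := mkR_surj _ (u.1 R)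
    rw [← hq, traceR_mkR, Set.inter_assoc, Set.inter_self]
  | succ S hS ih =>
    rw [ih, traceR_step u S, Set.inter_assoc,
      Set.inter_eq_self_of_subset_right (boxSet_mono_le hS)]

lemma traceU_inter_box (u : PhiInf N) (R : ℕ) :
    traceU N u ∩ boxSet N R = traceR N R (u.1 R) := by
  ext p
  constructor
  · rintro ⟨hp, hb⟩
    obtain ⟨S, hS⟩ := Set.mem_iUnion.1 hp
    rcases le_total R S with h | h
    · rw [traceR_le u h]; exact ⟨hS, hb⟩
    · rw [traceR_le u h] at hS; exact hS.1
  · intro hp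
    refine ⟨Set.mem_iUnion.2 ⟨R, hp⟩, ?_⟩
    rw [traceR_le u le_rfl] at hp
    exact hp.2

lemma traceU_inj {u w : PhiInf N} (h : traceU N u = traceU N w) : u = w := by
  apply Subtype.ext
  funext R
  apply traceR_inj
  rw [← traceU_inter_box, ← traceU_inter_box, h]

lemma exists_box (p : ℝ × (Fin N → ℝ)) : ∃ R, p ∈ boxSet N R := by
  obtain ⟨R, hR⟩ := exists_nat_ge (2 * max |p.1| ‖p.2‖)
  refine ⟨R, (mem_boxSet _ _).2 ⟨?_, ?_⟩⟩
  · have := le_max_left |p.1| ‖p.2‖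
    linarith
  · have := le_max_right |p.1| ‖p.2‖
    linarith

/-- On the box of size `R` an element of the scanning space is given by a path. -/
lemma exists_rep (u : PhiInf N) (R : ℕ) : ∃ q : PathsF N, mkR R q = u.1 R ∧
    ∀ p ∈ boxSet N R, p ∈ traceU N u ↔ p ∈ traceOf N q := by
  obtain ⟨q, hq⟩ := mkR_surj _ (u.1 R)
  refine ⟨q, hq, fun p hp => ?_⟩
  have := traceU_inter_box u R
  rw [← hq, traceR_mkR] at this
  have h2 := Set.ext_iff.1 this p
  simpa [hp] using h2

lemma continuous_proj (R : ℕ) : Continuous (fun u : PhiInf N => u.1 R) :=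
  (continuous_apply R).comp continuous_subtype_val

/-- The element of the scanning space given by a global path. -/
def ofPath (q : PathsF N) : PhiInf N := ⟨fun R => mkR R q, fun _ => rfl⟩

lemma continuous_ofPath : Continuous (ofPath (N := N)) :=
  Continuous.subtype_mk (continuous_pi fun R => continuous_mkR R) _

lemma traceU_ofPath (q : PathsF N) : traceU N (ofPath q) = traceOf N q := by
  ext p
  obtain ⟨R, hR⟩ := exists_box p
  have := Set.ext_iff.1 (traceU_inter_box (ofPath q) R) p
  change _ ↔ p ∈ traceOf N q ∩ boxSet N R at this
  simpa [hR] using this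

/-- Openness criterion: a set which at stage `R` is detected by an open condition on paths. -/
lemma isOpen_of_stage (R : ℕ) (A : Set (PhiInf N)) (V : Set (PathsF N)) (hV : IsOpen V)
    (h : ∀ u : PhiInf N, ∀ q, mkR R q = u.1 R → (u ∈ A ↔ q ∈ V))
    (hs : ∀ q q', mkR R q = mkR R q' → q ∈ V → q' ∈ V) : IsOpen A := by
  have h1 : IsOpen (mkR R '' V) := by
    rw [← (isQuotientMap_mkR R).isOpen_preimage]
    convert hV
    ext q
    constructor
    · rintro ⟨q', hq', e⟩
      exact hs _ _ e hq'
    · intro hq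
      exact ⟨q, hq, rfl⟩
  convert h1.preimage (continuous_proj R)
  ext u
  obtain ⟨q, hq⟩ := mkR_surj _ (u.1 R)
  rw [h u q hq, Set.mem_preimage]
  constructor
  · intro hq'
    exact ⟨q, hq', hq⟩
  · rintro ⟨q', hq', e⟩
    exact hs _ _ (e.trans hq.symm) hq'

/-- Openness of conditions on a slice. -/
lemma isOpen_slice (t : ℝ) (ρ : ℝ) (P : Set (Fin N → ℝ) → Prop)
    (hP : ∀ S S' : Set (Fin N → ℝ), (∀ x, ‖x‖ ≤ ρ → (x ∈ S ↔ x ∈ S')) → P S → P S')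
    (ho : ∀ n, IsOpen {f : ConfSp n (Fin N → ℝ) | P (Set.range f.1)}) :
    IsOpen {u : PhiInf N | P {x | (t, x) ∈ traceU N u}} := by
  obtain ⟨R, hR⟩ := exists_nat_ge (2 * max |t| ρ)
  have hb : ∀ x : Fin N → ℝ, ‖x‖ ≤ ρ → (t, x) ∈ boxSet N R := by
    intro x hx
    have h1 := le_max_left |t| ρ
    have h2 := le_max_right |t| ρ
    exact (mem_boxSet _ _).2 ⟨by simp only; linarith, by simp only; linarith⟩
  have hs : ∀ q q' : PathsF N, mkR R q = mkR R q' →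
      P {x | (t, x) ∈ traceOf N q} → P {x | (t, x) ∈ traceOf N q'} := by
    intro q q' h
    apply hP
    intro x hx
    have := Set.ext_iff.1 (mkR_eq.1 h) (t, x)
    simpa [hb x hx] using this
  refine isOpen_of_stage R _ {q : PathsF N | P {x | (t, x) ∈ traceOf N q}} ?_ ?_ hs
  · refine isOpen_sigma_iff.2 fun n => ?_
    have h1 : IsOpen {c : UConfSp n (Fin N → ℝ) | P {x | memConf x c}} := by
      rw [← isOpenQuotientMap_mkC.isQuotientMap.isOpen_preimage]
      convert ho n using 1
      ext f
      have : {x | memConf x (mkC f)} = Set.range f.1 := by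
        ext x
        exact memConf_mkC x f
      change P {x | memConf x (mkC f)} ↔ P (Set.range f.1)
      rw [this]
    exact h1.preimage (continuous_eval_const t :
      Continuous fun q : C(ℝ, UConfSp n (Fin N → ℝ)) => q t)
  · intro u q hq
    have e : ∀ x, ‖x‖ ≤ ρ → ((t, x) ∈ traceU N u ↔ (t, x) ∈ traceOf N q) := by
      intro x hx
      have := traceU_inter_box u R
      rw [← hq, traceR_mkR] at this
      have h2 := Set.ext_iff.1 this (t, x)
      simpa [hb x hx] using h2
    constructor
    · exact hP _ _ e
    · exact hP _ _ (fun x hx => (e x hx).symm)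

lemma isOpen_avoid (t : ℝ) (x₀ : Fin N → ℝ) (ε : ℝ) :
    IsOpen {u : PhiInf N | ∀ x, (t, x) ∈ traceU N u → ε < ‖x - x₀‖} := by
  refine isOpen_slice t (‖x₀‖ + ε) (fun S => ∀ x, x ∈ S → ε < ‖x - x₀‖) ?_ ?_
  · intro S S' h hS x hx
    by_contra hc
    push Not at hc
    have : ‖x‖ ≤ ‖x₀‖ + ε := by
      have := norm_add_le x₀ (x - x₀)
      rw [add_sub_cancel] at this
      linarith
    exact absurd (hS x ((h x this).2 hx)) (by linarith)
  · intro n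
    have : {f : ConfSp n (Fin N → ℝ) | ∀ x, x ∈ Set.range f.1 → ε < ‖x - x₀‖} =
        ⋂ i, {f : ConfSp n (Fin N → ℝ) | ε < ‖f.1 i - x₀‖} := by
      ext f; simp
    rw [this]
    exact isOpen_iInter_of_finite fun i =>
      isOpen_lt continuous_const ((continuous_confVal_apply i).sub continuous_const).norm

lemma isOpen_hit (t : ℝ) (x₀ : Fin N → ℝ) (ε : ℝ) :
    IsOpen {u : PhiInf N | ∃ x, (t, x) ∈ traceU N u ∧ ‖x - x₀‖ < ε} := by
  refine isOpen_slice t (‖x₀‖ + ε) (fun S => ∃ x, x ∈ S ∧ ‖x - x₀‖ < ε) ?_ ?_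
  · rintro S S' h ⟨x, hx, hx'⟩
    have : ‖x‖ ≤ ‖x₀‖ + ε := by
      have := norm_add_le x₀ (x - x₀)
      rw [add_sub_cancel] at this
      linarith
    exact ⟨x, (h x this).1 hx, hx'⟩
  · intro n
    have : {f : ConfSp n (Fin N → ℝ) | ∃ x, x ∈ Set.range f.1 ∧ ‖x - x₀‖ < ε} =
        ⋃ i, {f : ConfSp n (Fin N → ℝ) | ‖f.1 i - x₀‖ < ε} := by
      ext f; simp
    rw [this]
    exact isOpen_iUnion fun i =>
      isOpen_lt ((continuous_confVal_apply i).sub continuous_const).norm continuous_const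

/-- Slices of paths are finite. -/
lemma finite_slice (u : PhiInf N) (t ρ : ℝ) : {x | (t, x) ∈ traceU N u ∧ ‖x‖ ≤ ρ}.Finite := by
  obtain ⟨R, hR⟩ := exists_nat_ge (2 * max |t| ρ)
  obtain ⟨q, -, hq⟩ := exists_rep u R
  obtain ⟨f, hf⟩ := mkC_surj (q.2 t)
  refine (Set.finite_range f.1).subset ?_
  rintro x ⟨hx, hxρ⟩
  have h1 := le_max_left |t| ρ
  have h2 := le_max_right |t| ρ
  have := (hq (t, x) ((mem_boxSet _ _).2 ⟨by simp only; linarith, by simp only; linarith⟩)).1 hx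
  change memConf x (q.2 t) at this
  rw [← hf, memConf_mkC] at this
  exact this

/-- A point not on a slice has a neighbourhood missing it. -/
lemma exists_avoid (u : PhiInf N) (t : ℝ) (x₀ : Fin N → ℝ) (h : (t, x₀) ∉ traceU N u) :
    ∃ ε > 0, ∀ x, (t, x) ∈ traceU N u → ε < ‖x - x₀‖ := by
  have hfin := finite_slice u t (‖x₀‖ + 1)
  have hmem : {x | (t, x) ∈ traceU N u ∧ ‖x‖ ≤ ‖x₀‖ + 1}ᶜ ∈ nhds x₀ :=
    hfin.isClosed.isOpen_compl.mem_nhds (fun hc => h hc.1)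
  obtain ⟨ε, hε, hsub⟩ := Metric.mem_nhds_iff.1 hmem
  refine ⟨min (ε / 2) (1 / 2), by positivity, fun x hx => ?_⟩
  by_contra hc
  push Not at hc
  have h1 := hc.trans (min_le_left _ _)
  have h2 := hc.trans (min_le_right _ _)
  have : x ∈ Metric.ball x₀ ε := by
    rw [Metric.mem_ball, dist_eq_norm]; linarith
  refine hsub this ⟨hx, ?_⟩
  have := norm_add_le x₀ (x - x₀)
  rw [add_sub_cancel] at this
  linarith

instance instT2PhiInf : T2Space (PhiInf N) := by
  have key : ∀ u w : PhiInf N, ∀ p, p ∈ traceU N u → p ∉ traceU N w →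
      ∃ U V : Set (PhiInf N), IsOpen U ∧ IsOpen V ∧ u ∈ U ∧ w ∈ V ∧ Disjoint U V := by
    rintro u w ⟨t, x₀⟩ hu hw
    obtain ⟨ε, hε, h⟩ := exists_avoid w t x₀ hw
    refine ⟨_, _, isOpen_hit t x₀ ε, isOpen_avoid t x₀ ε, ⟨x₀, hu, by simpa using hε⟩, h, ?_⟩
    rw [Set.disjoint_left]
    rintro v ⟨x, hx, hx'⟩ hv
    exact absurd (hv x hx) (by linarith)
  refine ⟨fun u w huw => ?_⟩
  have : traceU N u ≠ traceU N w := fun h => huw (traceU_inj h)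
  by_cases hsub : traceU N u ⊆ traceU N w
  · have : ¬ traceU N w ⊆ traceU N u := fun h => this (hsub.antisymm h)
    obtain ⟨p, hp, hp'⟩ := Set.not_subset.1 this
    obtain ⟨U, V, hU, hV, h1, h2, h3⟩ := key w u p hp hp'
    exact ⟨V, U, hV, hU, h2, h1, h3.symm⟩
  · obtain ⟨p, hp, hp'⟩ := Set.not_subset.1 hsub
    exact key u w p hp hp'

end Phi

/-! ### The expansion homotopy -/

section Expand

variable {N : ℕ}

/-- Radial expansion, cut off outside of the region mapped to the box of size `R`. -/
def expR (R : ℕ) (a : NNReal) (x : Fin N → ℝ) : Fin N → ℝ :=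
  (max (1 - (a : ℝ) * ‖x‖) (1 / (1 + (a : ℝ) * ((R : ℝ) / 2))))⁻¹ • x

lemma expR_pos (R : ℕ) (a : NNReal) (x : Fin N → ℝ) :
    0 < max (1 - (a : ℝ) * ‖x‖) (1 / (1 + (a : ℝ) * ((R : ℝ) / 2))) :=
  lt_max_of_lt_right (by positivity)

lemma continuous_expR (R : ℕ) :
    Continuous (fun p : NNReal × (Fin N → ℝ) => expR R p.1 p.2) := by
  have hne : ∀ p : NNReal × (Fin N → ℝ),
      max (1 - (p.1 : ℝ) * ‖p.2‖) (1 / (1 + (p.1 : ℝ) * ((R : ℝ) / 2))) ≠ 0 :=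
    fun p => (expR_pos R p.1 p.2).ne'
  have hc2 : Continuous (fun p : NNReal × (Fin N → ℝ) =>
      (1 / (1 + (p.1 : ℝ) * ((R : ℝ) / 2)))) := by
    refine Continuous.div continuous_const (by fun_prop) ?_
    intro p
    have : (0 : ℝ) ≤ (p.1 : ℝ) := p.1.2
    positivity
  have hc1 : Continuous (fun p : NNReal × (Fin N → ℝ) => 1 - (p.1 : ℝ) * ‖p.2‖) := by fun_prop
  exact Continuous.smul (Continuous.inv₀ (hc1.max hc2) hne) continuous_snd

lemma norm_expR (R : ℕ) (a : NNReal) (x : Fin N → ℝ) : ‖expR R a x‖ =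
    (max (1 - (a : ℝ) * ‖x‖) (1 / (1 + (a : ℝ) * ((R : ℝ) / 2))))⁻¹ * ‖x‖ := by
  unfold expR
  rw [norm_smul, Real.norm_of_nonneg (inv_nonneg.2 (expR_pos R a x).le)]

lemma norm_expR_lt (R : ℕ) (a : NNReal) {x y : Fin N → ℝ} (h : ‖x‖ < ‖y‖) :
    ‖expR R a x‖ < ‖expR R a y‖ := by
  rw [norm_expR, norm_expR]
  have ha : (0 : ℝ) ≤ a := a.2
  have h1 : max (1 - (a : ℝ) * ‖y‖) (1 / (1 + (a : ℝ) * ((R : ℝ) / 2))) ≤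
      max (1 - (a : ℝ) * ‖x‖) (1 / (1 + (a : ℝ) * ((R : ℝ) / 2))) :=
    max_le_max (by nlinarith) le_rfl
  have h2 := inv_anti₀ (expR_pos R a y) h1
  have h3 := inv_pos.2 (expR_pos R a y)
  have h4 := norm_nonneg x
  nlinarith

lemma expR_injective (R : ℕ) (a : NNReal) : Function.Injective (expR (N := N) R a) := by
  intro x y hxy
  have hn : ‖x‖ = ‖y‖ := by
    rcases lt_trichotomy ‖x‖ ‖y‖ with h | h | h
    · exact absurd (congrArg norm hxy) (norm_expR_lt R a h).ne
    · exact h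
    · exact absurd (congrArg norm hxy) (norm_expR_lt R a h).ne'
  unfold expR at hxy
  rw [hn] at hxy
  exact smul_right_injective _ (inv_ne_zero (expR_pos R a y).ne') hxy

/-- The inverse of the expansion. -/
def shr (a : NNReal) (y : Fin N → ℝ) : Fin N → ℝ := (1 + (a : ℝ) * ‖y‖)⁻¹ • y

lemma norm_shr (a : NNReal) (y : Fin N → ℝ) : ‖shr a y‖ = (1 + (a : ℝ) * ‖y‖)⁻¹ * ‖y‖ := by
  unfold shr
  rw [norm_smul, Real.norm_of_nonneg (by positivity)]

lemma norm_shr_le (a : NNReal) (y : Fin N → ℝ) : ‖shr a y‖ ≤ ‖y‖ := by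
  rw [norm_shr]
  have : (1 + (a : ℝ) * ‖y‖)⁻¹ ≤ 1 := inv_le_one_of_one_le₀ (by
    have : 0 ≤ (a : ℝ) * ‖y‖ := by positivity
    linarith)
  have := norm_nonneg y
  nlinarith

lemma expR_shr (R : ℕ) (a : NNReal) (y : Fin N → ℝ) (hy : ‖y‖ ≤ (R : ℝ) / 2) :
    expR R a (shr a y) = y := by
  unfold expR
  rw [norm_shr]
  have ha : (0 : ℝ) ≤ a := a.2
  have hy0 := norm_nonneg y
  have hp : 0 < 1 + (a : ℝ) * ‖y‖ := by positivity
  have e : 1 - (a : ℝ) * ((1 + (a : ℝ) * ‖y‖)⁻¹ * ‖y‖) = (1 + (a : ℝ) * ‖y‖)⁻¹ := by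
    field_simp
    ring
  rw [e, max_eq_left, inv_inv]
  · unfold shr
    rw [smul_smul, mul_inv_cancel₀ hp.ne', one_smul]
  · rw [one_div]
    exact inv_anti₀ hp (by nlinarith)

lemma expR_eq_iff (R : ℕ) (a : NNReal) (x y : Fin N → ℝ) (hy : ‖y‖ ≤ (R : ℝ) / 2) :
    expR R a x = y ↔ x = shr a y := by
  constructor
  · intro h
    apply expR_injective R a
    rw [h, expR_shr R a y hy]
  · rintro rfl
    exact expR_shr R a y hy

/-- The expansion operation on paths. -/
def opPath (R : ℕ) (q : PathsF N) (p : NNReal × I) : PathsF N :=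
  ⟨q.1, ⟨fun t => cmap (expR R p.1) (expR_injective R p.1) (q.2 ((p.2 : ℝ) * t)),
    (continuous_cmap (expR (N := N) R) (expR_injective R) (continuous_expR R)).comp
      ((q.2.continuous.comp (by fun_prop)).prodMk continuous_const)⟩⟩

lemma continuous_opPath (R : ℕ) :
    Continuous (fun z : PathsF N × (NNReal × I) => opPath R z.1 z.2) := by
  let e : (PathsF N × (NNReal × I)) ≃ₜ
    (Σ n : ℕ, C(ℝ, UConfSp n (Fin N → ℝ)) × (NNReal × I)) := Homeomorph.sigmaProdDistrib
  rw [← e.symm.comp_continuous_iff']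
  refine continuous_sigma fun n => ?_
  have hsig : Continuous (fun c : C(ℝ, UConfSp n (Fin N → ℝ)) => (⟨n, c⟩ : PathsF N)) :=
    @continuous_sigmaMk ℕ (fun k => C(ℝ, UConfSp k (Fin N → ℝ))) _ _
  refine hsig.comp
    (f := fun z : C(ℝ, UConfSp n (Fin N → ℝ)) × (NNReal × I) =>
      (⟨fun t => cmap (expR R z.2.1) (expR_injective R z.2.1) (z.1 ((z.2.2 : ℝ) * t)),
        (opPath R ⟨n, z.1⟩ z.2).2.continuous⟩ : C(ℝ, UConfSp n (Fin N → ℝ)))) ?_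
  refine ContinuousMap.continuous_of_continuous_uncurry _ ?_
  refine (continuous_cmap (expR (N := N) R) (expR_injective R) (continuous_expR R)).comp
    (f := fun w : (C(ℝ, UConfSp n (Fin N → ℝ)) × (NNReal × I)) × ℝ =>
      (w.1.1 ((w.1.2.2 : ℝ) * w.2), w.1.2.1)) ?_
  fun_prop

lemma mem_traceOf (q : PathsF N) (t : ℝ) (x : Fin N → ℝ) :
    (t, x) ∈ traceOf N q ↔ memConf x (q.2 t) := Iff.rfl

lemma mem_traceOf_opPath (R : ℕ) (q : PathsF N) (p : NNReal × I) (t : ℝ) (y : Fin N → ℝ)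
    (hy : ‖y‖ ≤ (R : ℝ) / 2) :
    (t, y) ∈ traceOf N (opPath R q p) ↔ ((p.2 : ℝ) * t, shr p.1 y) ∈ traceOf N q := by
  rw [mem_traceOf, mem_traceOf]
  refine (memConf_cmap (expR R p.1) (expR_injective R p.1) _ _).trans ?_
  constructor
  · rintro ⟨x, hx, h⟩
    rw [expR_eq_iff R p.1 x y hy] at h
    rw [← h]; exact hx
  · intro h
    exact ⟨_, h, expR_shr R p.1 y hy⟩

lemma shr_mem_box {R : ℕ} (p : NNReal × I) {t : ℝ} {y : Fin N → ℝ} (h : (t, y) ∈ boxSet N R) :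
    ((p.2 : ℝ) * t, shr p.1 y) ∈ boxSet N R := by
  rw [mem_boxSet] at h ⊢
  refine ⟨?_, (norm_shr_le _ _).trans h.2⟩
  simp only at h ⊢
  rw [abs_mul, abs_of_nonneg p.2.2.1]
  have := p.2.2.2
  have := abs_nonneg t
  nlinarith [h.1]

/-- The expansion operation at stage `R`. -/
def opR (R : ℕ) (w : PhiR N R) (p : NNReal × I) : PhiR N R :=
  Quotient.map (fun q => opPath R q p) (by
    intro q q' h
    have h' : traceOf N q ∩ boxSet N R = traceOf N q' ∩ boxSet N R := h
    change traceOf N (opPath R q p) ∩ boxSet N R = traceOf N (opPath R q' p) ∩ boxSet N R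
    ext ⟨t, y⟩
    simp only [Set.mem_inter_iff, and_congr_left_iff]
    intro hb
    have hy := ((mem_boxSet _ _).1 hb).2
    rw [mem_traceOf_opPath R q p t y hy, mem_traceOf_opPath R q' p t y hy]
    have := Set.ext_iff.1 h' ((p.2 : ℝ) * t, shr p.1 y)
    simpa [shr_mem_box p hb] using this) w

lemma opR_mkR (R : ℕ) (q : PathsF N) (p : NNReal × I) :
    opR R (mkR R q) p = mkR R (opPath R q p) := rfl

lemma continuous_opR (R : ℕ) :
    Continuous (fun z : PhiR N R × (NNReal × I) => opR R z.1 z.2) := by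
  refine (isQuotientMap_mkR R).continuous_lift_prod_left
    (g := fun z : PhiR N R × (NNReal × I) => opR R z.1 z.2) ?_
  exact (continuous_mkR R).comp (continuous_opPath R)

lemma mem_traceR_opR (R : ℕ) (w : PhiR N R) (p : NNReal × I) (t : ℝ) (y : Fin N → ℝ) :
    (t, y) ∈ traceR N R (opR R w p) ↔
      (t, y) ∈ boxSet N R ∧ ((p.2 : ℝ) * t, shr p.1 y) ∈ traceR N R w := by
  obtain ⟨q, rfl⟩ := mkR_surj R w
  rw [opR_mkR, traceR_mkR, traceR_mkR]
  simp only [Set.mem_inter_iff]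
  constructor
  · rintro ⟨h, hb⟩
    exact ⟨hb, (mem_traceOf_opPath R q p t y ((mem_boxSet _ _).1 hb).2).1 h, shr_mem_box p hb⟩
  · rintro ⟨hb, h, -⟩
    exact ⟨(mem_traceOf_opPath R q p t y ((mem_boxSet _ _).1 hb).2).2 h, hb⟩

/-- The expansion operation on the scanning space. -/
def opU (u : PhiInf N) (p : NNReal × I) : PhiInf N :=
  ⟨fun R => opR R (u.1 R) p, fun R => by
    apply traceR_inj
    rw [traceR_res]
    ext ⟨t, y⟩
    rw [Set.mem_inter_iff, mem_traceR_opR, mem_traceR_opR]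
    rw [traceR_step u R]
    constructor
    · rintro ⟨⟨-, h⟩, hb⟩
      exact ⟨hb, h, shr_mem_box p hb⟩
    · rintro ⟨hb, h, -⟩
      exact ⟨⟨boxSet_mono N R hb, h⟩, hb⟩⟩

lemma continuous_opU : Continuous (fun z : PhiInf N × (NNReal × I) => opU z.1 z.2) := by
  refine Continuous.subtype_mk (continuous_pi fun R => ?_) _
  exact (continuous_opR R).comp
    (((continuous_proj R).comp continuous_fst).prodMk continuous_snd)

lemma mem_traceU_opU (u : PhiInf N) (p : NNReal × I) (t : ℝ) (y : Fin N → ℝ) :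
    (t, y) ∈ traceU N (opU u p) ↔ ((p.2 : ℝ) * t, shr p.1 y) ∈ traceU N u := by
  obtain ⟨R, hR⟩ := exists_box (t, y)
  have h1 := Set.ext_iff.1 (traceU_inter_box (opU u p) R) (t, y)
  have h2 := Set.ext_iff.1 (traceU_inter_box u R) ((p.2 : ℝ) * t, shr p.1 y)
  have h3 := mem_traceR_opR R (u.1 R) p t y
  simp only [Set.mem_inter_iff, hR, shr_mem_box p hR, and_true, true_and] at h1 h2 h3
  rw [h1, h2]
  exact h3

end Expand

section Second

variable {N : ℕ}

/-- Inverse radii of pairs of distinct points in the zero slice. -/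
def pairSet (u : PhiInf N) : Set ℝ :=
  {c | ∃ x y : Fin N → ℝ, ((0 : ℝ), x) ∈ traceU N u ∧ ((0 : ℝ), y) ∈ traceU N u ∧ x ≠ y ∧
    c = 1 / max ‖x‖ ‖y‖}

/-- The inverse of the distance from the origin to the second nearest point. -/
def invD (u : PhiInf N) : ℝ := sSup (pairSet u)

lemma max_pos_of_ne {x y : Fin N → ℝ} (h : x ≠ y) : 0 < max ‖x‖ ‖y‖ := by
  by_contra hc
  push Not at hc
  have h1 := (le_max_left _ _).trans hc
  have h2 := (le_max_right _ _).trans hc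
  exact h ((norm_le_zero_iff.1 h1).trans (norm_le_zero_iff.1 h2).symm)

lemma bddAbove_pairSet (u : PhiInf N) : BddAbove (pairSet u) := by
  have hf := finite_slice u 0 1
  have h2 := ((hf.prod hf).image (fun p => 1 / max ‖p.1‖ ‖p.2‖)).bddAbove
  refine (h2.union (bddAbove_Iic (a := (1 : ℝ)))).mono ?_
  rintro c ⟨x, y, hx, hy, hxy, rfl⟩
  by_cases h : max ‖x‖ ‖y‖ ≤ 1
  · left
    exact ⟨(x, y), ⟨⟨hx, (le_max_left _ _).trans h⟩, ⟨hy, (le_max_right _ _).trans h⟩⟩, rfl⟩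
  · right
    push Not at h
    simp only [Set.mem_Iic]
    rw [div_le_one (by linarith)]
    exact h.le

lemma invD_nonneg (u : PhiInf N) : 0 ≤ invD u := by
  apply Real.sSup_nonneg
  rintro c ⟨x, y, hx, hy, hxy, rfl⟩
  positivity

lemma le_invD (u : PhiInf N) {x y : Fin N → ℝ} (hx : ((0 : ℝ), x) ∈ traceU N u)
    (hy : ((0 : ℝ), y) ∈ traceU N u) (hxy : x ≠ y) : 1 / max ‖x‖ ‖y‖ ≤ invD u :=
  le_csSup (bddAbove_pairSet u) ⟨x, y, hx, hy, hxy, rfl⟩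

lemma invD_le (u : PhiInf N) {r : ℝ} (hr : 0 < r)
    (h : ∀ x y : Fin N → ℝ, ((0 : ℝ), x) ∈ traceU N u → ((0 : ℝ), y) ∈ traceU N u →
      ‖x‖ < r → ‖y‖ < r → x = y) : invD u ≤ 1 / r := by
  apply Real.sSup_le _ (by positivity)
  rintro c ⟨x, y, hx, hy, hxy, rfl⟩
  apply one_div_le_one_div_of_le hr
  by_contra hc
  push Not at hc
  exact hxy (h x y hx hy ((le_max_left _ _).trans_lt hc) ((le_max_right _ _).trans_lt hc))

lemma isOpen_two (ρ : ℝ) : IsOpen {u : PhiInf N | ∃ x y : Fin N → ℝ,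
    ((0 : ℝ), x) ∈ traceU N u ∧ ((0 : ℝ), y) ∈ traceU N u ∧ x ≠ y ∧ ‖x‖ < ρ ∧ ‖y‖ < ρ} := by
  refine isOpen_slice 0 ρ (fun S => ∃ x y : Fin N → ℝ, x ∈ S ∧ y ∈ S ∧ x ≠ y ∧ ‖x‖ < ρ ∧ ‖y‖ < ρ)
    ?_ ?_
  · rintro S S' h ⟨x, y, hx, hy, hxy, h1, h2⟩
    exact ⟨x, y, (h x h1.le).1 hx, (h y h2.le).1 hy, hxy, h1, h2⟩
  · intro n
    have : {f : ConfSp n (Fin N → ℝ) | ∃ x y : Fin N → ℝ, x ∈ Set.range f.1 ∧ y ∈ Set.range f.1 ∧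
        x ≠ y ∧ ‖x‖ < ρ ∧ ‖y‖ < ρ} =
        ⋃ i, ⋃ j, ⋃ (_ : i ≠ j), ({f : ConfSp n (Fin N → ℝ) | ‖f.1 i‖ < ρ} ∩
          {f : ConfSp n (Fin N → ℝ) | ‖f.1 j‖ < ρ}) := by
      ext f
      simp only [Set.mem_iUnion]
      constructor
      · rintro ⟨_, _, ⟨i, rfl⟩, ⟨j, rfl⟩, hij, h1, h2⟩
        exact ⟨i, j, fun h => hij (by rw [h]), h1, h2⟩
      · rintro ⟨i, j, hij, h1, h2⟩
        exact ⟨_, _, ⟨i, rfl⟩, ⟨j, rfl⟩, fun h => hij (f.2 h), h1, h2⟩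
    rw [this]
    exact isOpen_iUnion fun i => isOpen_iUnion fun j => isOpen_iUnion fun _ =>
      (isOpen_lt (continuous_confVal_apply i).norm continuous_const).inter
        (isOpen_lt (continuous_confVal_apply j).norm continuous_const)

lemma isOpen_one (ρ : ℝ) : IsOpen {u : PhiInf N | ∀ x y : Fin N → ℝ,
    ((0 : ℝ), x) ∈ traceU N u → ((0 : ℝ), y) ∈ traceU N u → ‖x‖ ≤ ρ → ‖y‖ ≤ ρ → x = y} := by
  refine isOpen_slice 0 ρ (fun S => ∀ x y : Fin N → ℝ, x ∈ S → y ∈ S → ‖x‖ ≤ ρ → ‖y‖ ≤ ρ → x = y)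
    ?_ ?_
  · intro S S' h hS x y hx hy h1 h2
    exact hS x y ((h x h1).2 hx) ((h y h2).2 hy) h1 h2
  · intro n
    have : {f : ConfSp n (Fin N → ℝ) | ∀ x y : Fin N → ℝ, x ∈ Set.range f.1 → y ∈ Set.range f.1 →
        ‖x‖ ≤ ρ → ‖y‖ ≤ ρ → x = y} =
        ⋂ i, ⋂ j, ⋂ (_ : i ≠ j), ({f : ConfSp n (Fin N → ℝ) | ρ < ‖f.1 i‖} ∪
          {f : ConfSp n (Fin N → ℝ) | ρ < ‖f.1 j‖}) := by
      ext f
      simp only [Set.mem_iInter]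
      constructor
      · intro h i j hij
        by_contra hc
        have hc' : ¬ (ρ < ‖f.1 i‖ ∨ ρ < ‖f.1 j‖) := hc
        push Not at hc'
        exact hij (f.2 (h _ _ ⟨i, rfl⟩ ⟨j, rfl⟩ hc'.1 hc'.2))
      · rintro h _ _ ⟨i, rfl⟩ ⟨j, rfl⟩ h1 h2
        by_contra hc
        have hij : i ≠ j := fun e => hc (by rw [e])
        have h' : ρ < ‖f.1 i‖ ∨ ρ < ‖f.1 j‖ := h i j hij
        rcases h' with h' | h' <;> linarith
    rw [this]
    exact isOpen_iInter_of_finite fun i => isOpen_iInter_of_finite fun j =>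
      isOpen_iInter_of_finite fun _ =>
      (isOpen_lt continuous_const (continuous_confVal_apply i).norm).union
        (isOpen_lt continuous_const (continuous_confVal_apply j).norm)

lemma continuous_invD : Continuous (invD (N := N)) := by
  rw [OrderTopology.continuous_iff]
  intro a
  constructor
  · rw [isOpen_iff_forall_mem_open]
    intro u hu
    have hu' : a < invD u := hu
    by_cases hne : (pairSet u).Nonempty
    · obtain ⟨c, ⟨x, y, hx, hy, hxy, rfl⟩, hc⟩ := exists_lt_of_lt_csSup hne hu'
      have hm := max_pos_of_ne hxy
      have hA : ∃ a', 0 < a' ∧ a ≤ a' ∧ a' < 1 / max ‖x‖ ‖y‖ := by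
        have h0 : 0 < 1 / max ‖x‖ ‖y‖ := by positivity
        obtain ⟨a', h1, h2⟩ := exists_between (max_lt hc h0)
        exact ⟨a', (le_max_right _ _).trans_lt h1, ((le_max_left _ _).trans_lt h1).le, h2⟩
      obtain ⟨a', ha0, haa, ha1⟩ := hA
      have hlt : max ‖x‖ ‖y‖ < 1 / a' := by
        rw [lt_div_iff₀ hm] at ha1
        rw [lt_div_iff₀ ha0]; linarith
      refine ⟨_, ?_, isOpen_two (1 / a'), ⟨x, y, hx, hy, hxy,
        (le_max_left _ _).trans_lt hlt, (le_max_right _ _).trans_lt hlt⟩⟩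
      rintro w ⟨x', y', hx', hy', hxy', h1, h2⟩
      have h3 := le_invD w hx' hy' hxy'
      have h4 := max_lt h1 h2
      have h5 := max_pos_of_ne hxy'
      have : a' < 1 / max ‖x'‖ ‖y'‖ := by
        rw [lt_div_iff₀ ha0] at h4
        rw [lt_div_iff₀ h5]; linarith
      exact haa.trans_lt (this.trans_le h3)
    · rw [Set.not_nonempty_iff_eq_empty] at hne
      have h0 : invD u = 0 := by unfold invD; rw [hne, Real.sSup_empty]
      refine ⟨Set.univ, fun w _ => ?_, isOpen_univ, trivial⟩
      have := invD_nonneg w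
      change a < invD w
      linarith
  · rw [isOpen_iff_forall_mem_open]
    intro u hu
    have hu' : invD u < a := hu
    obtain ⟨c, hc1, hc2⟩ := exists_between hu'
    have hc0 : 0 < c := (invD_nonneg u).trans_lt hc1
    refine ⟨_, ?_, isOpen_one (1 / c), ?_⟩
    · intro w hw
      have h1 : invD w ≤ 1 / (1 / c) := invD_le w (by positivity)
        (fun x y hx hy h1 h2 => hw x y hx hy h1.le h2.le)
      rw [one_div_one_div] at h1
      exact h1.trans_lt hc2
    · intro x y hx hy h1 h2
      by_contra hxy
      have h3 := le_invD u hx hy hxy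
      have h4 := max_pos_of_ne hxy
      have h5 := max_le h1 h2
      have : c ≤ 1 / max ‖x‖ ‖y‖ := by
        rw [le_div_iff₀ hc0] at h5
        rw [le_div_iff₀ h4]; linarith
      linarith

/-- The parameters of the scanning homotopy. -/
def hParam (z : I × PhiInf N) : NNReal × I :=
  (Real.toNNReal ((z.1 : ℝ) * invD z.2), unitInterval.symm z.1)

lemma continuous_hParam : Continuous (hParam (N := N)) := by
  have h1 : Continuous (fun z : I × PhiInf N => (z.1 : ℝ) * invD z.2) :=
    (continuous_subtype_val.comp continuous_fst).mul (continuous_invD.comp continuous_snd)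
  exact (continuous_real_toNNReal.comp h1).prodMk (unitInterval.continuous_symm.comp continuous_fst)

/-- The underlying function of the scanning homotopy. -/
def scanF (z : I × PhiInf N) : PhiInf N := opU z.2 (hParam z)

lemma continuous_scanF : Continuous (scanF (N := N)) := by
  have h1 : Continuous (fun z : I × PhiInf N => (z.2, hParam z)) :=
    Continuous.prodMk continuous_snd continuous_hParam
  exact Continuous.comp (g := fun z : PhiInf N × (NNReal × I) => opU z.1 z.2)
    (f := fun z : I × PhiInf N => (z.2, hParam z)) continuous_opU h1

/-- The scanning homotopy. -/
def scanH : C(I × PhiInf N, PhiInf N) := ⟨scanF, continuous_scanF⟩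

lemma mem_scanH (s : I) (u : PhiInf N) (t : ℝ) (y : Fin N → ℝ) :
    (t, y) ∈ traceU N (scanH (s, u)) ↔
      ((1 - (s : ℝ)) * t, (1 + (s : ℝ) * invD u * ‖y‖)⁻¹ • y) ∈ traceU N u := by
  have h := mem_traceU_opU u (hParam (s, u)) t y
  have e : ((hParam (s, u)).1 : ℝ) = (s : ℝ) * invD u :=
    Real.coe_toNNReal _ (mul_nonneg s.2.1 (invD_nonneg u))
  unfold shr at h
  rw [e] at h
  exact h

lemma scanH_zero (u : PhiInf N) : scanH (0, u) = u := by
  apply traceU_inj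
  ext ⟨t, y⟩
  rw [mem_scanH]
  simp

/-- The constant path at a single point. -/
def singPath (x : Fin N → ℝ) : PathsF N :=
  ⟨1, ContinuousMap.const ℝ (mkC ⟨fun _ => x, fun i j _ => Subsingleton.elim i j⟩)⟩

/-- The empty path. -/
def emptyPath : PathsF N :=
  ⟨0, ContinuousMap.const ℝ (mkC ⟨fun i => i.elim0, fun i => i.elim0⟩)⟩

lemma mem_singPath (x : Fin N → ℝ) (t : ℝ) (y : Fin N → ℝ) :
    (t, y) ∈ traceOf N (singPath x) ↔ y = x := by
  rw [mem_traceOf]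
  refine (memConf_mkC y _).trans ?_
  constructor
  · rintro ⟨i, h⟩; exact h.symm
  · intro h; exact ⟨(0 : Fin 1), h.symm⟩

lemma mem_emptyPath (t : ℝ) (y : Fin N → ℝ) : (t, y) ∉ traceOf N (emptyPath (N := N)) := by
  rw [mem_traceOf]
  intro h
  obtain ⟨i, -⟩ := (memConf_mkC y _).1 h
  exact i.elim0

lemma continuous_singPath : Continuous (singPath (N := N)) := by
  have hsig : Continuous (fun c : C(ℝ, UConfSp 1 (Fin N → ℝ)) => (⟨1, c⟩ : PathsF N)) :=
    @continuous_sigmaMk ℕ (fun k => C(ℝ, UConfSp k (Fin N → ℝ))) _ _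
  refine hsig.comp
    (f := fun x : Fin N → ℝ => ContinuousMap.const ℝ
      (mkC (⟨fun _ => x, fun i j _ => Subsingleton.elim i j⟩ : ConfSp 1 (Fin N → ℝ)))) ?_
  refine ContinuousMap.continuous_const'.comp (continuous_mkC.comp ?_)
  exact Continuous.subtype_mk (continuous_pi fun _ => continuous_id) _

/-- The embedding of the one-point compactification into the scanning space. -/
def sing : OnePoint (Fin N → ℝ) → PhiInf N
  | OnePoint.infty => ofPath emptyPath
  | OnePoint.some x => ofPath (singPath x)

lemma sing_some (x : Fin N → ℝ) : sing (x : OnePoint (Fin N → ℝ)) = ofPath (singPath x) := rfl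

lemma sing_infty : sing (OnePoint.infty : OnePoint (Fin N → ℝ)) = ofPath emptyPath := rfl

lemma mem_sing_some (x : Fin N → ℝ) (t : ℝ) (y : Fin N → ℝ) :
    (t, y) ∈ traceU N (sing (x : OnePoint (Fin N → ℝ))) ↔ y = x := by
  rw [sing_some, traceU_ofPath, mem_singPath]

lemma mem_sing_infty (t : ℝ) (y : Fin N → ℝ) :
    (t, y) ∉ traceU N (sing (OnePoint.infty : OnePoint (Fin N → ℝ))) := by
  rw [sing_infty, traceU_ofPath]
  exact mem_emptyPath t y

lemma continuous_sing : Continuous (sing (N := N)) := by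
  rw [OnePoint.continuous_iff]
  refine ⟨?_, continuous_ofPath.comp continuous_singPath⟩
  have hind : Topology.IsInducing (fun u : PhiInf N => u.1) := Topology.IsInducing.subtypeVal
  rw [hind.tendsto_nhds_iff, tendsto_pi_nhds]
  intro R
  refine tendsto_const_nhds.congr' ?_
  rw [Filter.coclosedCompact_eq_cocompact]
  filter_upwards [(isCompact_closedBall (0 : Fin N → ℝ) ((R : ℝ) / 2)).compl_mem_cocompact]
    with x hx
  change mkR R emptyPath = mkR R (singPath x)
  rw [mkR_eq]
  ext ⟨t, y⟩
  simp only [Set.mem_inter_iff, mem_emptyPath, false_and, mem_singPath, false_iff]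
  rintro ⟨rfl, hb⟩
  exact hx (by simpa using ((mem_boxSet _ _).1 hb).2)

lemma sing_injective : Function.Injective (sing (N := N)) := by
  intro p q h
  induction p using OnePoint.rec with
  | infty =>
    induction q using OnePoint.rec with
    | infty => rfl
    | coe y =>
      have := (mem_sing_some y 0 y).2 rfl
      rw [← h] at this
      exact absurd this (mem_sing_infty 0 y)
  | coe x =>
    have h1 := (mem_sing_some x 0 x).2 rfl
    rw [h] at h1
    induction q using OnePoint.rec with
    | infty => exact absurd h1 (mem_sing_infty 0 x)
    | coe y => rw [(mem_sing_some y 0 x).1 h1]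

lemma isEmbedding_sing : Topology.IsEmbedding (sing (N := N)) :=
  (continuous_sing.isClosedEmbedding sing_injective).isEmbedding

lemma eq_sing_some {u : PhiInf N} (x : Fin N → ℝ)
    (h : ∀ t y, (t, y) ∈ traceU N u ↔ y = x) : sing (x : OnePoint (Fin N → ℝ)) = u := by
  apply traceU_inj
  ext ⟨t, y⟩
  rw [mem_sing_some, h]

lemma scanH_one (u : PhiInf N) : ∃ p, sing p = scanH (1, u) := by
  have huniq : ∀ t t' y y', (t, y) ∈ traceU N (scanH (1, u)) →
      (t', y') ∈ traceU N (scanH (1, u)) → y = y' := by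
    intro t t' y y' h h'
    rw [mem_scanH] at h h'
    simp only [Set.Icc.coe_one, sub_self, zero_mul, one_mul] at h h'
    have hd := invD_nonneg u
    have key : ∀ z : Fin N → ℝ, invD u * ‖(1 + invD u * ‖z‖)⁻¹ • z‖ < 1 := by
      intro z
      have hp : 0 < 1 + invD u * ‖z‖ := by positivity
      rw [norm_smul, Real.norm_of_nonneg (by positivity), inv_mul_eq_div, mul_div_assoc',
        div_lt_one hp]
      linarith
    have heq : (1 + invD u * ‖y‖)⁻¹ • y = (1 + invD u * ‖y'‖)⁻¹ • y' := by
      by_contra hne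
      have h1 := le_invD u h h' hne
      have h2 := max_pos_of_ne hne
      rw [div_le_iff₀ h2] at h1
      rcases max_choice ‖(1 + invD u * ‖y‖)⁻¹ • y‖ ‖(1 + invD u * ‖y'‖)⁻¹ • y'‖ with e | e
      · rw [e] at h1; linarith [key y]
      · rw [e] at h1; linarith [key y']
    obtain ⟨R, hR⟩ := exists_nat_ge (2 * max ‖y‖ ‖y'‖)
    have e1 := expR_shr R ⟨invD u, hd⟩ y (by linarith [le_max_left ‖y‖ ‖y'‖])
    have e2 := expR_shr R ⟨invD u, hd⟩ y' (by linarith [le_max_right ‖y‖ ‖y'‖])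
    rw [← e1, ← e2]
    congr 1
  have hconst : ∀ t t' y, (t, y) ∈ traceU N (scanH (1, u)) → (t', y) ∈ traceU N (scanH (1, u)) := by
    intro t t' y h
    rw [mem_scanH] at h ⊢
    simpa using h
  by_cases hne : ∃ t y, (t, y) ∈ traceU N (scanH (1, u))
  · obtain ⟨t₀, x, hx⟩ := hne
    refine ⟨(x : OnePoint (Fin N → ℝ)), eq_sing_some x fun t y => ⟨fun h => huniq _ _ _ _ h hx, ?_⟩⟩
    rintro rfl
    exact hconst _ _ _ hx
  · push Not at hne
    refine ⟨OnePoint.infty, traceU_inj ?_⟩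
    ext ⟨t, y⟩
    simp [mem_sing_infty, hne]

lemma invD_sing (p : OnePoint (Fin N → ℝ)) : invD (sing p) = 0 := by
  have : pairSet (sing p) = ∅ := by
    ext c
    simp only [Set.mem_empty_iff_false, iff_false]
    rintro ⟨x, y, hx, hy, hxy, -⟩
    induction p using OnePoint.rec with
    | infty => exact mem_sing_infty 0 x hx
    | coe z => exact hxy (((mem_sing_some z 0 x).1 hx).trans ((mem_sing_some z 0 y).1 hy).symm)
  unfold invD
  rw [this, Real.sSup_empty]

lemma scanH_sing (s : I) (p : OnePoint (Fin N → ℝ)) : scanH (s, sing p) = sing p := by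
  apply traceU_inj
  ext ⟨t, y⟩
  rw [mem_scanH, invD_sing]
  simp only [mul_zero, zero_mul, add_zero, inv_one, one_smul]
  induction p using OnePoint.rec with
  | infty => simp [mem_sing_infty]
  | coe z => simp [mem_sing_some]

end Second

/-! ### Extraction of graphs -/

section Graph

variable {N : ℕ}

/-- Cut-off sum over a configuration. -/
def cutSum {n : ℕ} (χ : ℝ → ℝ) (v : Fin N → ℝ) : UConfSp n (Fin N → ℝ) → (Fin N → ℝ) :=
  Quotient.lift (fun f : ConfSp n (Fin N → ℝ) => ∑ i, χ ‖f.1 i‖ • (f.1 i - v)) (by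
    rintro f g ⟨e, he⟩
    rw [← he]
    exact (Equiv.sum_comp e (fun i => χ ‖f.1 i‖ • (f.1 i - v))).symm)

lemma cutSum_mkC {n : ℕ} (χ : ℝ → ℝ) (v : Fin N → ℝ) (f : ConfSp n (Fin N → ℝ)) :
    cutSum χ v (mkC f) = ∑ i, χ ‖f.1 i‖ • (f.1 i - v) := rfl

lemma continuous_cutSum {n : ℕ} (χ : ℝ → ℝ) (hχ : Continuous χ) :
    Continuous (fun p : (Fin N → ℝ) × UConfSp n (Fin N → ℝ) => cutSum χ p.1 p.2) := by
  have hq : IsOpenQuotientMap (Prod.map (id : (Fin N → ℝ) → (Fin N → ℝ))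
      (mkC (n := n) (X := Fin N → ℝ))) :=
    IsOpenQuotientMap.id.prodMap isOpenQuotientMap_mkC
  rw [hq.isQuotientMap.continuous_iff]
  change Continuous (fun p : (Fin N → ℝ) × ConfSp n (Fin N → ℝ) =>
    ∑ i, χ ‖p.2.1 i‖ • (p.2.1 i - p.1))
  refine continuous_finsetSum _ fun i _ => ?_
  have h1 : Continuous (fun p : (Fin N → ℝ) × ConfSp n (Fin N → ℝ) => p.2.1 i) :=
    (continuous_confVal_apply i).comp continuous_snd
  exact (hχ.comp h1.norm).smul (h1.sub continuous_fst)

/-- The cut-off function. -/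
def cutF (r e s : ℝ) : ℝ := max 0 (min 1 ((r + 2 * e - s) / e))

lemma continuous_cutF (r e : ℝ) : Continuous (cutF r e) := by
  unfold cutF
  fun_prop

lemma cutF_nonneg (r e s : ℝ) : 0 ≤ cutF r e s := le_max_left _ _

lemma cutF_le_one (r e s : ℝ) : cutF r e s ≤ 1 :=
  max_le zero_le_one (min_le_left _ _)

lemma cutF_eq_one {r e s : ℝ} (he : 0 < e) (h : s ≤ r + e) : cutF r e s = 1 := by
  unfold cutF
  rw [min_eq_left, max_eq_right zero_le_one]
  rw [le_div_iff₀ he]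
  linarith

lemma cutF_eq_zero {r e s : ℝ} (he : 0 < e) (h : r + 2 * e ≤ s) : cutF r e s = 0 := by
  unfold cutF
  apply max_eq_left
  apply (min_le_right _ _).trans
  exact div_nonpos_of_nonpos_of_nonneg (by linarith) he.le

lemma graph_extract (q : PathsF N) (g0 : C(ℝ, Fin N → ℝ)) {r' r'' e : ℝ} (hr : 0 < r')
    (he : 0 < e) (hrr : r' + 2 * e ≤ r'')
    (h1 : ∀ t, |t| < r' → ∀ x y, memConf x (q.2 t) → memConf y (q.2 t) → ‖x‖ ≤ r'' → ‖y‖ ≤ r'' →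
      x = y)
    (h2 : ∀ t, |t| < r' → ∀ x, memConf x (q.2 t) → ‖x‖ ≤ r'' → ‖x - g0 t‖ < e)
    (h3 : ∀ t, |t| < r' → r' + e ≤ ‖g0 t‖ ∨ ∃ x, memConf x (q.2 t) ∧ ‖x‖ ≤ r'') :
    ∃ g : C(ℝ, Fin N → ℝ), (∀ t, |t| < r' → ∀ x, ‖x‖ < r' → (memConf x (q.2 t) ↔ x = g t)) ∧
      ‖g 0 - g0 0‖ < e := by
  let χ := cutF r' e
  have hg : Continuous (fun t => g0 t + cutSum χ (g0 t) (q.2 t)) :=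
    g0.continuous.add ((continuous_cutSum χ (continuous_cutF r' e)).comp
      (g0.continuous.prodMk q.2.continuous))
  -- evaluation of the sum
  have ev0 : ∀ t, (∀ x, memConf x (q.2 t) → r'' < ‖x‖) → cutSum χ (g0 t) (q.2 t) = 0 := by
    intro t h
    obtain ⟨f, hf⟩ := mkC_surj (q.2 t)
    rw [← hf, cutSum_mkC]
    refine Finset.sum_eq_zero fun i _ => ?_
    have : r'' < ‖f.1 i‖ := h _ (by rw [← hf, memConf_mkC]; exact ⟨i, rfl⟩)
    have : χ ‖f.1 i‖ = 0 := cutF_eq_zero he (by linarith)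
    rw [this, zero_smul]
  have ev1 : ∀ t, |t| < r' → ∀ x, memConf x (q.2 t) → ‖x‖ ≤ r'' →
      cutSum χ (g0 t) (q.2 t) = χ ‖x‖ • (x - g0 t) := by
    intro t ht x hx hxr
    obtain ⟨f, hf⟩ := mkC_surj (q.2 t)
    have hx' := hx
    rw [← hf, memConf_mkC] at hx'
    obtain ⟨i, rfl⟩ := hx'
    rw [← hf, cutSum_mkC]
    refine Finset.sum_eq_single i (fun j _ hj => ?_) (fun h => absurd (Finset.mem_univ i) h)
    have hjm : memConf (f.1 j) (q.2 t) := by rw [← hf, memConf_mkC]; exact ⟨j, rfl⟩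
    have : r'' < ‖f.1 j‖ := by
      by_contra hc
      push Not at hc
      exact hj (f.2 (h1 t ht _ _ hjm hx hc hxr))
    have : χ ‖f.1 j‖ = 0 := cutF_eq_zero he (by linarith)
    rw [this, zero_smul]
  refine ⟨⟨_, hg⟩, ?_, ?_⟩
  · intro t ht x hxr
    change _ ↔ x = g0 t + cutSum χ (g0 t) (q.2 t)
    constructor
    · intro hx
      have : χ ‖x‖ = 1 := cutF_eq_one he (by linarith)
      rw [ev1 t ht x hx (by linarith), this, one_smul, add_sub_cancel]
    · intro hx
      by_cases hex : ∃ y, memConf y (q.2 t) ∧ ‖y‖ ≤ r''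
      · obtain ⟨y, hy, hyr⟩ := hex
        rw [ev1 t ht y hy hyr] at hx
        have h5 := h2 t ht y hy hyr
        have hxy : ‖y - x‖ < e := by
          have e1 : y - x = (1 - χ ‖y‖) • (y - g0 t) := by
            rw [hx, sub_smul, one_smul]; abel
          rw [e1, norm_smul, Real.norm_of_nonneg (by linarith [cutF_le_one r' e ‖y‖])]
          have := cutF_nonneg r' e ‖y‖
          have := norm_nonneg (y - g0 t)
          change (1 - cutF r' e ‖y‖) * _ < e
          nlinarith
        have hy2 : ‖y‖ ≤ r' + e := by
          have := norm_add_le x (y - x)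
          rw [add_sub_cancel] at this
          linarith
        have : χ ‖y‖ = 1 := cutF_eq_one he hy2
        rw [this, one_smul, add_sub_cancel] at hx
        rw [hx]; exact hy
      · exfalso
        have h3' := (h3 t ht).resolve_right hex
        push Not at hex
        rw [ev0 t hex, add_zero] at hx
        rw [hx] at hxr
        linarith
  · change ‖g0 0 + cutSum χ (g0 0) (q.2 0) - g0 0‖ < e
    rw [add_sub_cancel_left]
    have h0 : |(0 : ℝ)| < r' := by simpa using hr
    by_cases hex : ∃ y, memConf y (q.2 0) ∧ ‖y‖ ≤ r''
    · obtain ⟨y, hy, hyr⟩ := hex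
      rw [ev1 0 h0 y hy hyr, norm_smul, Real.norm_of_nonneg (cutF_nonneg _ _ _)]
      have := cutF_nonneg r' e ‖y‖
      have := cutF_le_one r' e ‖y‖
      have := norm_nonneg (y - g0 0)
      have h5 := h2 0 h0 y hy hyr
      change cutF r' e ‖y‖ * _ < e
      nlinarith
    · push Not at hex
      rw [ev0 0 hex, norm_zero]
      exact he

lemma mem_ball_iff {r t : ℝ} {x : Fin N → ℝ} :
    (t, x) ∈ Metric.ball (0 : ℝ × (Fin N → ℝ)) r ↔ |t| < r ∧ ‖x‖ < r := by
  rw [mem_ball_zero_iff, Prod.norm_def, max_lt_iff]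
  rfl

/-- Restatement of the condition defining the second open set. -/
lemma mem_U1 (u : PhiInf N) : u ∈ U1set N ↔ ∃ r > (0 : ℝ), ∃ g : C(ℝ, Fin N → ℝ), ‖g 0‖ < r ∧
    ∀ t, |t| < r → ∀ x, ‖x‖ < r → ((t, x) ∈ traceU N u ↔ x = g t) := by
  constructor
  · rintro ⟨r, hr, g, hg, h⟩
    refine ⟨r, hr, g, (mem_ball_iff.1 hg).2, fun t ht x hx => ?_⟩
    have := Set.ext_iff.1 h (t, x)
    have hb : (t, x) ∈ Metric.ball (0 : ℝ × (Fin N → ℝ)) r := mem_ball_iff.2 ⟨ht, hx⟩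
    simpa [-Metric.mem_ball, hb] using this
  · rintro ⟨r, hr, g, hg, h⟩
    refine ⟨r, hr, g, mem_ball_iff.2 ⟨by simpa using hr, hg⟩, ?_⟩
    ext ⟨t, x⟩
    simp only [Set.mem_inter_iff, and_congr_left_iff]
    intro hb
    exact h t (mem_ball_iff.1 hb).1 x (mem_ball_iff.1 hb).2

/-- Restatement of the condition defining the first open set. -/
lemma mem_U0' (u : PhiInf N) : u ∈ U0set N ↔ ∃ r > (0 : ℝ),
    ∀ t, |t| < r → ∀ x, ‖x‖ < r → (t, x) ∉ traceU N u := by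
  constructor
  · rintro ⟨r, hr, h⟩
    refine ⟨r, hr, fun t ht x hx hm => ?_⟩
    have : (t, x) ∈ traceU N u ∩ Metric.ball (0 : ℝ × (Fin N → ℝ)) r :=
      ⟨hm, mem_ball_iff.2 ⟨ht, hx⟩⟩
    rw [h] at this
    exact this
  · rintro ⟨r, hr, h⟩
    refine ⟨r, hr, ?_⟩
    ext ⟨t, x⟩
    simp only [Set.mem_inter_iff, Set.mem_empty_iff_false, iff_false]
    rintro ⟨hm, hb⟩
    exact h t (mem_ball_iff.1 hb).1 x (mem_ball_iff.1 hb).2 hm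

lemma isOpen_confAll {n : ℕ} {T : Type} [TopologicalSpace T] (ρ : T → (Fin N → ℝ) → Prop)
    (h : IsOpen {p : T × (Fin N → ℝ) | ρ p.1 p.2}) :
    IsOpen {p : T × UConfSp n (Fin N → ℝ) | ∀ x, memConf x p.2 → ρ p.1 x} := by
  refine isOpen_conf (fun t c => ∀ x, memConf x c → ρ t x) ?_
  have : {p : T × ConfSp n (Fin N → ℝ) | ∀ x, memConf x (mkC p.2) → ρ p.1 x} =
      ⋂ i, {p : T × ConfSp n (Fin N → ℝ) | ρ p.1 (p.2.1 i)} := by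
    ext p
    simp only [Set.mem_iInter]
    constructor
    · intro hp i
      exact hp _ ((memConf_mkC _ _).2 ⟨i, rfl⟩)
    · intro hp x hx
      obtain ⟨i, rfl⟩ := (memConf_mkC _ _).1 hx
      exact hp i
  rw [this]
  exact isOpen_iInter_of_finite fun i => h.preimage
    (continuous_fst.prodMk ((continuous_confVal_apply i).comp continuous_snd))

lemma isOpen_confEx {n : ℕ} {T : Type} [TopologicalSpace T] (ρ : T → (Fin N → ℝ) → Prop)
    (h : IsOpen {p : T × (Fin N → ℝ) | ρ p.1 p.2}) :
    IsOpen {p : T × UConfSp n (Fin N → ℝ) | ∃ x, memConf x p.2 ∧ ρ p.1 x} := by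
  refine isOpen_conf (fun t c => ∃ x, memConf x c ∧ ρ t x) ?_
  have : {p : T × ConfSp n (Fin N → ℝ) | ∃ x, memConf x (mkC p.2) ∧ ρ p.1 x} =
      ⋃ i, {p : T × ConfSp n (Fin N → ℝ) | ρ p.1 (p.2.1 i)} := by
    ext p
    simp only [Set.mem_iUnion]
    constructor
    · rintro ⟨x, hx, hp⟩
      obtain ⟨i, rfl⟩ := (memConf_mkC _ _).1 hx
      exact ⟨i, hp⟩
    · rintro ⟨i, hp⟩
      exact ⟨_, (memConf_mkC _ _).2 ⟨i, rfl⟩, hp⟩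
  rw [this]
  exact isOpen_iUnion fun i => h.preimage
    (continuous_fst.prodMk ((continuous_confVal_apply i).comp continuous_snd))

lemma isOpen_confOne {n : ℕ} {T : Type} [TopologicalSpace T] (r : ℝ) :
    IsOpen {p : T × UConfSp n (Fin N → ℝ) |
      ∀ x y, memConf x p.2 → memConf y p.2 → ‖x‖ ≤ r → ‖y‖ ≤ r → x = y} := by
  refine isOpen_conf (fun _ c => ∀ x y, memConf x c → memConf y c → ‖x‖ ≤ r → ‖y‖ ≤ r → x = y) ?_
  have : {p : T × ConfSp n (Fin N → ℝ) | ∀ x y, memConf x (mkC p.2) → memConf y (mkC p.2) →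
        ‖x‖ ≤ r → ‖y‖ ≤ r → x = y} =
      ⋂ i, ⋂ j, ⋂ (_ : i ≠ j), ({p : T × ConfSp n (Fin N → ℝ) | r < ‖p.2.1 i‖} ∪
          {p : T × ConfSp n (Fin N → ℝ) | r < ‖p.2.1 j‖}) := by
    ext p
    simp only [Set.mem_iInter]
    constructor
    · intro h i j hij
      by_contra hc
      have hc' : ¬ (r < ‖p.2.1 i‖ ∨ r < ‖p.2.1 j‖) := hc
      push Not at hc'
      exact hij (p.2.2 (h _ _ ((memConf_mkC _ _).2 ⟨i, rfl⟩) ((memConf_mkC _ _).2 ⟨j, rfl⟩)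
        hc'.1 hc'.2))
    · intro h x y hx hy h1 h2
      obtain ⟨i, rfl⟩ := (memConf_mkC _ _).1 hx
      obtain ⟨j, rfl⟩ := (memConf_mkC _ _).1 hy
      by_contra hc
      have hij : i ≠ j := fun e => hc (by rw [e])
      have h' : r < ‖p.2.1 i‖ ∨ r < ‖p.2.1 j‖ := h i j hij
      rcases h' with h' | h' <;> linarith
  rw [this]
  exact isOpen_iInter_of_finite fun i => isOpen_iInter_of_finite fun j =>
    isOpen_iInter_of_finite fun _ =>
    (isOpen_lt continuous_const ((continuous_confVal_apply i).comp continuous_snd).norm).union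
      (isOpen_lt continuous_const ((continuous_confVal_apply j).comp continuous_snd).norm)

/-- Conditions open in the configuration persist for nearby times. -/
lemma eventually_time (q : PathsF N) (P : UConfSp q.1 (Fin N → ℝ) → Prop)
    (hP : IsOpen {p : Unit × UConfSp q.1 (Fin N → ℝ) | P p.2}) (t₀ : ℝ) (h : P (q.2 t₀)) :
    ∃ δ > 0, ∀ t, |t - t₀| < δ → P (q.2 t) := by
  have ho : IsOpen {t : ℝ | P (q.2 t)} :=
    hP.preimage ((continuous_const (y := ())).prodMk q.2.continuous)
  obtain ⟨δ, hδ, hsub⟩ := Metric.isOpen_iff.1 ho t₀ h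
  exact ⟨δ, hδ, fun t ht => hsub (by rw [Metric.mem_ball, Real.dist_eq]; exact ht)⟩

lemma mem_U0 (u : PhiInf N) : u ∈ U0set N ↔ ((0 : ℝ), (0 : Fin N → ℝ)) ∉ traceU N u := by
  rw [mem_U0']
  constructor
  · rintro ⟨r, hr, h⟩
    exact h 0 (by simpa using hr) 0 (by simpa using hr)
  · intro h
    obtain ⟨ε, hε, h'⟩ := exists_avoid u 0 0 h
    obtain ⟨q, -, hq⟩ := exists_rep u 1
    have hb : ∀ (t : ℝ) (x : Fin N → ℝ), |t| ≤ 1 / 2 → ‖x‖ ≤ 1 / 2 → (t, x) ∈ boxSet N 1 :=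
      fun t x ht hx => (mem_boxSet _ _).2 ⟨by simpa using ht, by simpa using hx⟩
    obtain ⟨δ, hδ, hd⟩ := eventually_time q (fun c => ∀ x, memConf x c → min ε (1 / 4) < ‖x‖)
      (isOpen_confAll (fun _ x => min ε (1 / 4) < ‖x‖)
        (isOpen_lt continuous_const continuous_snd.norm)) 0 (by
        intro x hx
        by_contra hc
        push Not at hc
        have h1 : ‖x‖ ≤ 1 / 2 := by linarith [min_le_right ε (1 / 4)]
        have h2 := (hq (0, x) (hb 0 x (by norm_num) h1)).2 hx
        have h3 := h' x h2
        rw [sub_zero] at h3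
        linarith [min_le_left ε (1 / 4)])
    refine ⟨min δ (min ε (1 / 4)), by positivity, fun t ht x hx hm => ?_⟩
    have a1 := min_le_left δ (min ε (1 / 4))
    have a2 := min_le_right δ (min ε (1 / 4))
    have a3 := min_le_right ε (1 / 4)
    have := hd t (by rw [sub_zero]; linarith) x
      ((hq (t, x) (hb t x (by linarith) (by linarith))).1 hm)
    linarith

lemma isOpen_U0 : IsOpen (U0set N) := by
  rw [isOpen_iff_forall_mem_open]
  intro u hu
  obtain ⟨ε, hε, h⟩ := exists_avoid u 0 0 ((mem_U0 u).1 hu)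
  refine ⟨_, ?_, isOpen_avoid 0 0 ε, h⟩
  intro w hw
  rw [mem_U0]
  intro hm
  have := hw 0 hm
  simp at this
  linarith

lemma U_cover : U0set N ∪ U1set N = Set.univ := by
  rw [Set.eq_univ_iff_forall]
  intro u
  by_cases h0 : u ∈ U0set N
  · exact Or.inl h0
  right
  rw [mem_U0, not_not] at h0
  rw [mem_U1]
  obtain ⟨q, -, hq⟩ := exists_rep u 1
  have hb : ∀ (t : ℝ) (x : Fin N → ℝ), |t| ≤ 1 / 2 → ‖x‖ ≤ 1 / 2 → (t, x) ∈ boxSet N 1 :=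
    fun t x ht hx => (mem_boxSet _ _).2 ⟨by simpa using ht, by simpa using hx⟩
  -- isolate the origin in the zero slice
  have hs : ∃ s > 0, s ≤ 1 / 2 ∧ ∀ x, memConf x (q.2 0) → ‖x‖ ≤ s → x = 0 := by
    have hfin := (finite_slice u 0 (1 / 2)).subset (t := {x | ((0 : ℝ), x) ∈ traceU N u ∧
      ‖x‖ ≤ 1 / 2 ∧ x ≠ 0}) (fun x hx => ⟨hx.1, hx.2.1⟩)
    have hmem : {x | ((0 : ℝ), x) ∈ traceU N u ∧ ‖x‖ ≤ 1 / 2 ∧ x ≠ 0}ᶜ ∈ nhds (0 : Fin N → ℝ) :=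
      hfin.isClosed.isOpen_compl.mem_nhds (fun hc => hc.2.2 rfl)
    obtain ⟨ε, hε, hsub⟩ := Metric.mem_nhds_iff.1 hmem
    refine ⟨min (ε / 2) (1 / 2), by positivity, min_le_right _ _, fun x hx hxs => ?_⟩
    have b1 := min_le_left (ε / 2) (1 / 2)
    have b2 := min_le_right (ε / 2) (1 / 2)
    by_contra hne
    refine hsub (show x ∈ Metric.ball 0 ε by rw [mem_ball_zero_iff]; linarith)
      ⟨(hq (0, x) (hb 0 x (by norm_num) (by linarith))).2 hx, by linarith, hne⟩
  obtain ⟨s, hs0, hs2, hs⟩ := hs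
  have hm0 : memConf (0 : Fin N → ℝ) (q.2 0) :=
    (hq (0, 0) (hb 0 0 (by norm_num) (by norm_num))).1 h0
  obtain ⟨δ1, hδ1, hd1⟩ := eventually_time q
    (fun c => ∀ x y, memConf x c → memConf y c → ‖x‖ ≤ s → ‖y‖ ≤ s → x = y)
    (isOpen_confOne s) 0 (fun x y hx hy h1 h2 => (hs x hx h1).trans (hs y hy h2).symm)
  obtain ⟨δ2, hδ2, hd2⟩ := eventually_time q
    (fun c => ∃ x, memConf x c ∧ ‖x‖ < s / 4)
    (isOpen_confEx (fun _ x => ‖x‖ < s / 4) (isOpen_lt continuous_snd.norm continuous_const)) 0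
    ⟨0, hm0, by simpa using hs0⟩
  set r := min (min δ1 δ2) (s / 2) with hr
  have hr0 : 0 < r := by positivity
  have c1 : r ≤ δ1 := (min_le_left _ _).trans (min_le_left _ _)
  have c2 : r ≤ δ2 := (min_le_left _ _).trans (min_le_right _ _)
  have c3 : r ≤ s / 2 := min_le_right _ _
  obtain ⟨g, hg, -⟩ := graph_extract q (ContinuousMap.const ℝ 0) (r' := r) (r'' := s) (e := s / 4)
    hr0 (by positivity) (by linarith)
    (fun t ht => hd1 t (by rw [sub_zero]; linarith))
    (by
      intro t ht x hx hxs
      obtain ⟨y, hy, hys⟩ := hd2 t (by rw [sub_zero]; linarith)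
      have := hd1 t (by rw [sub_zero]; linarith) x y hx hy hxs (by linarith)
      rw [this]
      simpa using hys)
    (by
      intro t ht
      obtain ⟨y, hy, hys⟩ := hd2 t (by rw [sub_zero]; linarith)
      exact Or.inr ⟨y, hy, by linarith⟩)
  have hg0 : (0 : Fin N → ℝ) = g 0 := (hg 0 (by simpa using hr0) 0 (by simpa using hr0)).1 hm0
  refine ⟨r, hr0, g, by rw [← hg0]; simpa using hr0, fun t ht x hx => ?_⟩
  rw [hq (t, x) (hb t x (by linarith) (by linarith))]
  exact hg t ht x hx

end Graph
/-! ### The second open set, invariance -/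

section Inv

variable {N : ℕ}

/-- Paths which look like a single graph near the origin. -/
def graphPaths (N R : ℕ) : Set (PathsF N) :=
  {q | ∃ r > (0 : ℝ), r ≤ (R : ℝ) / 2 ∧ ∃ g : C(ℝ, Fin N → ℝ), ‖g 0‖ < r ∧
    ∀ t, |t| < r → ∀ x, ‖x‖ < r → (memConf x (q.2 t) ↔ x = g t)}

lemma isOpen_graphPaths (R : ℕ) : IsOpen (graphPaths N R) := by
  refine isOpen_sigma_iff.2 fun n => ?_
  rw [isOpen_iff_forall_mem_open]
  rintro c ⟨r, hr, hrR, g, hg0, hg⟩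
  have hg' : ∀ t, |t| < r → ∀ x, ‖x‖ < r → (memConf x (c t) ↔ x = g t) := hg
  set e := (r - ‖g 0‖) / 8 with he
  have he0 : 0 < e := by rw [he]; linarith
  have hρ : ‖g 0‖ = r - 8 * e := by rw [he]; ring
  have hρ0 := norm_nonneg (g 0)
  let W : Set (ℝ × UConfSp n (Fin N → ℝ)) :=
    ({p | ∀ x y, memConf x p.2 → memConf y p.2 → ‖x‖ ≤ r - 2 * e → ‖y‖ ≤ r - 2 * e → x = y} ∩
    {p | ∀ x, memConf x p.2 → (r - 2 * e < ‖x‖ ∨ ‖x - g p.1‖ < e)}) ∩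
    ({p | r - 3 * e < ‖g p.1‖} ∪ {p | ∃ x, memConf x p.2 ∧ ‖x‖ < r - 2 * e})
  have hW : IsOpen W := by
    refine IsOpen.inter (IsOpen.inter (isOpen_confOne _) ?_) (IsOpen.union ?_ ?_)
    · refine isOpen_confAll (fun t x => r - 2 * e < ‖x‖ ∨ ‖x - g t‖ < e) ?_
      exact (isOpen_lt continuous_const continuous_snd.norm).union
        (isOpen_lt (continuous_snd.sub (g.continuous.comp continuous_fst)).norm continuous_const)
    · exact isOpen_lt continuous_const (g.continuous.comp continuous_fst).norm
    · exact isOpen_confEx (fun _ x => ‖x‖ < r - 2 * e)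
        (isOpen_lt continuous_snd.norm continuous_const)
  let K : Set ℝ := Set.Icc (-(r - 4 * e)) (r - 4 * e)
  have hK : IsCompact K := isCompact_Icc
  let A : Set C(ℝ, UConfSp n (Fin N → ℝ)) := {c' | ∀ t ∈ K, (t, c' t) ∈ W}
  have hA : IsOpen A := by
    have h1 := ContinuousMap.isOpen_setOfPred_mapsTo hK hW
    have h2 : Continuous (fun c' : C(ℝ, UConfSp n (Fin N → ℝ)) =>
        (ContinuousMap.id ℝ).prodMk c') := by
      refine ContinuousMap.continuous_of_continuous_uncurry _ ?_
      change Continuous (fun z : C(ℝ, UConfSp n (Fin N → ℝ)) × ℝ => (z.2, z.1 z.2))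
      fun_prop
    exact h1.preimage h2
  refine ⟨A, ?_, hA, ?_⟩
  · intro c' hc'
    have hin : ∀ t, |t| < r - 4 * e → (t, c' t) ∈ W :=
      fun t ht => hc' t ⟨(abs_lt.1 ht).1.le, (abs_lt.1 ht).2.le⟩
    obtain ⟨g1, hg1, hg2⟩ := graph_extract (⟨n, c'⟩ : PathsF N) g (r' := r - 4 * e)
      (r'' := r - 2 * e) (e := e) (by linarith) he0 (by linarith)
      (fun t ht => (hin t ht).1.1)
      (by
        intro t ht x hx hxr
        rcases (hin t ht).1.2 x hx with h | h
        · linarith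
        · exact h)
      (by
        intro t ht
        rcases (hin t ht).2 with h | ⟨x, hx, hxr⟩
        · left
          have h' : r - 3 * e < ‖g t‖ := h
          linarith
        · exact Or.inr ⟨x, hx, hxr.le⟩)
    refine ⟨r - 4 * e, by linarith, by linarith, g1, ?_, hg1⟩
    have := norm_add_le (g 0) (g1 0 - g 0)
    rw [add_sub_cancel] at this
    linarith
  · intro t ht
    have ht' : |t| < r := by
      have := abs_le.2 ⟨ht.1, ht.2⟩
      linarith
    refine ⟨⟨?_, ?_⟩, ?_⟩
    · intro x y hx hy hxr hyr
      exact ((hg' t ht' x (by linarith)).1 hx).trans ((hg' t ht' y (by linarith)).1 hy).symm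
    · intro x hx
      by_cases h : r - 2 * e < ‖x‖
      · exact Or.inl h
      · right
        have := (hg' t ht' x (by linarith)).1 hx
        change ‖x - g t‖ < e
        rw [this, sub_self, norm_zero]
        exact he0
    · by_cases h : r - 3 * e < ‖g t‖
      · exact Or.inl h
      · right
        exact ⟨g t, (hg' t ht' (g t) (by linarith)).2 rfl, by linarith⟩

lemma isOpen_U1 : IsOpen (U1set N) := by
  have hbox : ∀ (R : ℕ) (r t : ℝ) (x : Fin N → ℝ), r ≤ (R : ℝ) / 2 → |t| < r → ‖x‖ < r →
      (t, x) ∈ boxSet N R := fun R r t x hR ht hx =>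
    (mem_boxSet _ _).2 ⟨by simp only; linarith, by simp only; linarith⟩
  have key : ∀ R : ℕ, IsOpen {u : PhiInf N | ∃ r > (0 : ℝ), r ≤ (R : ℝ) / 2 ∧
      ∃ g : C(ℝ, Fin N → ℝ), ‖g 0‖ < r ∧
      ∀ t, |t| < r → ∀ x, ‖x‖ < r → ((t, x) ∈ traceU N u ↔ x = g t)} := by
    intro R
    refine isOpen_of_stage R _ _ (isOpen_graphPaths R) ?_ ?_
    · intro u q hq
      have h1 : ∀ p ∈ boxSet N R, p ∈ traceU N u ↔ p ∈ traceOf N q := by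
        intro p hp
        have := traceU_inter_box u R
        rw [← hq, traceR_mkR] at this
        have h2 := Set.ext_iff.1 this p
        simpa [hp] using h2
      constructor
      · rintro ⟨r, hr, hR, g, hg0, hg⟩
        refine ⟨r, hr, hR, g, hg0, fun t ht x hx => ?_⟩
        rw [← hg t ht x hx]
        exact (h1 _ (hbox R r t x hR ht hx)).symm
      · rintro ⟨r, hr, hR, g, hg0, hg⟩
        refine ⟨r, hr, hR, g, hg0, fun t ht x hx => ?_⟩
        rw [← hg t ht x hx]
        exact h1 _ (hbox R r t x hR ht hx)
    · rintro q q' hqq ⟨r, hr, hR, g, hg0, hg⟩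
      refine ⟨r, hr, hR, g, hg0, fun t ht x hx => ?_⟩
      rw [← hg t ht x hx]
      have := Set.ext_iff.1 (mkR_eq.1 hqq) (t, x)
      have h2 : (t, x) ∈ traceOf N q ↔ (t, x) ∈ traceOf N q' := by
        simpa [hbox R r t x hR ht hx] using this
      exact h2.symm
  have e : U1set N = ⋃ R : ℕ, {u : PhiInf N | ∃ r > (0 : ℝ), r ≤ (R : ℝ) / 2 ∧
      ∃ g : C(ℝ, Fin N → ℝ), ‖g 0‖ < r ∧
      ∀ t, |t| < r → ∀ x, ‖x‖ < r → ((t, x) ∈ traceU N u ↔ x = g t)} := by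
    ext u
    rw [mem_U1, Set.mem_iUnion]
    constructor
    · rintro ⟨r, hr, g, hg⟩
      obtain ⟨R, hR⟩ := exists_nat_ge (2 * r)
      exact ⟨R, r, hr, by linarith, g, hg⟩
    · rintro ⟨R, r, hr, -, g, hg⟩
      exact ⟨r, hr, g, hg⟩
  rw [e]
  exact isOpen_iUnion key

lemma scanH_U0 (s : I) (u : PhiInf N) (hu : u ∈ U0set N) : scanH (s, u) ∈ U0set N := by
  rw [mem_U0] at hu ⊢
  rw [mem_scanH]
  simpa using hu

lemma scanH_U1 (s : I) (u : PhiInf N) (hu : u ∈ U1set N) : scanH (s, u) ∈ U1set N := by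
  rw [mem_U1] at hu ⊢
  obtain ⟨r, hr, g, hg0, hg⟩ := hu
  have hD : invD u ≤ 1 / r := by
    refine invD_le u hr fun x y hx hy h1 h2 => ?_
    have h0 : |(0 : ℝ)| < r := by simpa using hr
    exact ((hg 0 h0 x h1).1 hx).trans ((hg 0 h0 y h2).1 hy).symm
  have hD0 := invD_nonneg u
  have hs0 : (0 : ℝ) ≤ s := s.2.1
  have hs1 : (s : ℝ) ≤ 1 := s.2.2
  obtain ⟨r1, hr1, hr2⟩ := exists_between hg0
  have hρ0 := norm_nonneg (g 0)
  have hr10 : 0 < r1 := by linarith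
  set a : ℝ := (s : ℝ) * invD u with ha
  have ha0 : 0 ≤ a := mul_nonneg hs0 hD0
  have har : a * r ≤ s := by
    rw [le_div_iff₀ hr] at hD
    nlinarith
  have har1 : a * r1 ≤ s := by nlinarith
  have har2 : a * r1 < 1 := by
    rcases ha0.eq_or_lt with h | h
    · rw [← h]; simp
    · nlinarith
  have hpos : 0 < 1 - a * r1 := by linarith
  have hcont : Continuous (fun t : ℝ =>
      (max (1 - a * ‖g ((1 - (s : ℝ)) * t)‖) (1 - a * r1))⁻¹ • g ((1 - (s : ℝ)) * t)) := by
    have h1 : Continuous (fun t : ℝ => g ((1 - (s : ℝ)) * t)) := by fun_prop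
    refine Continuous.smul (Continuous.inv₀ ?_ fun t => (lt_max_of_lt_right hpos).ne') h1
    exact (continuous_const.sub (continuous_const.mul h1.norm)).max continuous_const
  refine ⟨r1 / (1 - a * r1), by positivity, ⟨_, hcont⟩, ?_, ?_⟩
  · change ‖(max (1 - a * ‖g ((1 - (s : ℝ)) * 0)‖) (1 - a * r1))⁻¹ • g ((1 - (s : ℝ)) * 0)‖ < _
    rw [mul_zero, norm_smul, max_eq_left (by nlinarith),
      Real.norm_of_nonneg (inv_nonneg.2 (by nlinarith)), inv_mul_eq_div,
      div_lt_div_iff₀ (by nlinarith) hpos]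
    nlinarith
  · intro t ht y hy
    rw [mem_scanH]
    change _ ↔ y =
      (max (1 - a * ‖g ((1 - (s : ℝ)) * t)‖) (1 - a * r1))⁻¹ • g ((1 - (s : ℝ)) * t)
    rw [lt_div_iff₀ hpos] at ht hy
    have hy0 := norm_nonneg y
    have hay : 0 < 1 + a * ‖y‖ := by positivity
    have hn : ‖(1 + a * ‖y‖)⁻¹ • y‖ = ‖y‖ / (1 + a * ‖y‖) := by
      rw [norm_smul, Real.norm_of_nonneg (by positivity), inv_mul_eq_div]
    have hlt : ‖(1 + a * ‖y‖)⁻¹ • y‖ < r1 := by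
      rw [hn, div_lt_iff₀ hay]
      nlinarith
    have ht2 : |(1 - (s : ℝ)) * t| < r := by
      rw [abs_mul, abs_of_nonneg (by linarith)]
      have := abs_nonneg t
      nlinarith
    rw [hg _ ht2 _ (by linarith)]
    constructor
    · intro h
      rw [← h, hn, max_eq_left (by rw [hn] at hlt; nlinarith)]
      have : 1 - a * (‖y‖ / (1 + a * ‖y‖)) = (1 + a * ‖y‖)⁻¹ := by
        field_simp
        ring
      rw [this, inv_inv, smul_smul, mul_inv_cancel₀ hay.ne', one_smul]
    · intro h
      set x := g ((1 - (s : ℝ)) * t) with hx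
      set m := max (1 - a * ‖x‖) (1 - a * r1) with hm
      have hm0 : 0 < m := lt_max_of_lt_right hpos
      have hny : ‖y‖ * m = ‖x‖ := by
        rw [h, norm_smul, Real.norm_of_nonneg (by positivity)]
        field_simp
      have hxr : ‖x‖ < r1 := by
        rcases max_choice (1 - a * ‖x‖) (1 - a * r1) with e | e
        · rw [hm, e] at hny
          by_contra hc
          push Not at hc
          have : 1 - a * ‖x‖ ≤ 1 - a * r1 := by nlinarith
          nlinarith
        · rw [hm, e] at hny
          linarith
      have hmx : m = 1 - a * ‖x‖ := max_eq_left (by nlinarith)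
      have : (1 + a * ‖y‖) * m = 1 := by
        have : (1 + a * ‖y‖) * m = m + a * (‖y‖ * m) := by ring
        rw [this, hny, hmx]; ring
      have h2 : (1 + a * ‖y‖)⁻¹ = m := by
        rw [inv_eq_iff_eq_inv]
        exact eq_inv_of_mul_eq_one_left this
      rw [h2, h, smul_smul, mul_inv_cancel₀ hm0.ne', one_smul]

lemma sing_U0 (p : OnePoint (Fin N → ℝ)) :
    sing p ∈ U0set N ↔ p ≠ ((0 : Fin N → ℝ) : OnePoint (Fin N → ℝ)) := by
  rw [mem_U0]
  induction p using OnePoint.rec with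
  | infty => simp [mem_sing_infty]
  | coe z =>
    rw [mem_sing_some, not_iff_not, OnePoint.coe_eq_coe]
    exact eq_comm

lemma sing_U1 (p : OnePoint (Fin N → ℝ)) : sing p ∈ U1set N ↔ p ≠ OnePoint.infty := by
  rw [mem_U1]
  induction p using OnePoint.rec with
  | infty =>
    simp only [mem_sing_infty, ne_eq, not_true_eq_false, iff_false]
    rintro ⟨r, hr, g, hg0, hg⟩
    exact (hg 0 (by simpa using hr) (g 0) hg0).2 rfl
  | coe z =>
    simp only [ne_eq, OnePoint.coe_ne_infty, not_false_eq_true, iff_true]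
    refine ⟨‖z‖ + 1, by positivity, ContinuousMap.const ℝ z, by simp, fun t _ x _ => ?_⟩
    rw [mem_sing_some]; rfl

/-- Deformation retraction of an invariant set onto its part of the one-point
compactification. -/
def retU (U : Set (PhiInf N)) (hU : ∀ s u, u ∈ U → scanH (s, u) ∈ U) :
    ContinuousMap.HomotopyEquiv U {p : OnePoint (Fin N → ℝ) // sing p ∈ U} :=
  defRet (X := U) (Y := {p : OnePoint (Fin N → ℝ) // sing p ∈ U})
    ⟨fun p => ⟨sing p.1, p.2⟩,
      Continuous.subtype_mk (continuous_sing.comp continuous_subtype_val) _⟩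
    (Topology.IsEmbedding.of_comp
      (Continuous.subtype_mk (continuous_sing.comp continuous_subtype_val) _)
      continuous_subtype_val
      (isEmbedding_sing.comp Topology.IsEmbedding.subtypeVal))
    ⟨fun z => ⟨scanH (z.1, z.2.1), hU _ _ z.2.2⟩,
      Continuous.subtype_mk (scanH.continuous.comp
        (continuous_fst.prodMk (continuous_subtype_val.comp continuous_snd))) _⟩
    (fun u => Subtype.ext (scanH_zero u.1))
    (fun u => by
      obtain ⟨p, hp⟩ := scanH_one u.1
      exact ⟨⟨p, by rw [hp]; exact hU _ _ u.2⟩, Subtype.ext hp⟩)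
    (fun p => Subtype.ext (scanH_sing 1 p.1))

/-- The scanning space deformation retracts onto the one-point compactification. -/
def retAll : ContinuousMap.HomotopyEquiv (PhiInf N) (OnePoint (Fin N → ℝ)) :=
  defRet ⟨sing, continuous_sing⟩ isEmbedding_sing scanH scanH_zero scanH_one
    (fun p => scanH_sing 1 p)

end Inv
/-! ### Conclusions -/

section Final

variable {N : ℕ}

lemma finrank_fin_add_one (N : ℕ) :
    Module.finrank ℝ (Fin N → ℝ) + 1 = Fintype.card (Fin (N + 1)) := by simp

lemma contractible_U0 : ContractibleSpace (U0set N) := by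
  let h : OnePoint (Fin N → ℝ) ≃ₜ Metric.sphere (0 : EuclideanSpace ℝ (Fin (N + 1))) 1 :=
    onePointEquivSphereOfFinrankEq (finrank_fin_add_one N)
  let v := h ((0 : Fin N → ℝ) : OnePoint (Fin N → ℝ))
  have : Fact (Module.finrank ℝ (EuclideanSpace ℝ (Fin (N + 1))) = N + 1) := ⟨by simp⟩
  let st := stereographic' N v
  have e1 : {p : OnePoint (Fin N → ℝ) // sing p ∈ U0set N} ≃ₜ st.source :=
    h.subtype (fun p => by
      rw [sing_U0, stereographic'_source, Set.mem_compl_iff, Set.mem_singleton_iff, not_iff_not]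
      exact h.injective.eq_iff.symm)
  have e2 : st.source ≃ₜ EuclideanSpace ℝ (Fin N) :=
    (st.toHomeomorphSourceTarget.trans
      (Homeomorph.setCongr (stereographic'_target v))).trans (Homeomorph.Set.univ _)
  have : ContractibleSpace {p : OnePoint (Fin N → ℝ) // sing p ∈ U0set N} :=
    (e1.trans e2).contractibleSpace
  exact (retU (U0set N) (fun s u hu => scanH_U0 s u hu)).contractibleSpace

lemma contractible_U1 : ContractibleSpace (U1set N) := by
  have hr : Set.range ((↑) : (Fin N → ℝ) → OnePoint (Fin N → ℝ)) =
      {p | sing p ∈ U1set N} := by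
    ext p
    rw [Set.mem_ofPred_eq, sing_U1, OnePoint.ne_infty_iff_exists]
    rfl
  have e : (Fin N → ℝ) ≃ₜ {p : OnePoint (Fin N → ℝ) // sing p ∈ U1set N} :=
    OnePoint.isOpenEmbedding_coe.isEmbedding.toHomeomorph.trans (Homeomorph.setCongr hr)
  have : ContractibleSpace {p : OnePoint (Fin N → ℝ) // sing p ∈ U1set N} :=
    e.symm.contractibleSpace
  exact (retU (U1set N) (fun s u hu => scanH_U1 s u hu)).contractibleSpace

lemma weak_inter : WeaklyEquivalent (↥(U0set N ∩ U1set N))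
    (Metric.sphere (0 : EuclideanSpace ℝ (Fin N)) 1) := by
  let E := EuclideanSpace ℝ (Fin N)
  let w : E ≃ₜ (Fin N → ℝ) := (EuclideanSpace.equiv (Fin N) ℝ).toHomeomorph
  let f : ({0}ᶜ : Set E) → OnePoint (Fin N → ℝ) := fun x => ((w x.1 : Fin N → ℝ) : OnePoint _)
  have hf : Topology.IsEmbedding f :=
    OnePoint.isOpenEmbedding_coe.isEmbedding.comp
      (w.isEmbedding.comp Topology.IsEmbedding.subtypeVal)
  have hw0 : w 0 = 0 := rfl
  have hr : Set.range f = {p | sing p ∈ U0set N ∩ U1set N} := by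
    ext p
    rw [Set.mem_ofPred_eq, Set.mem_inter_iff, sing_U0, sing_U1]
    constructor
    · rintro ⟨x, rfl⟩
      refine ⟨?_, OnePoint.coe_ne_infty _⟩
      intro h
      have h1 : w x.1 = w 0 := OnePoint.coe_injective h
      exact x.2 (w.injective h1)
    · rintro ⟨h0, h1⟩
      obtain ⟨y, rfl⟩ := OnePoint.ne_infty_iff_exists.1 h1
      refine ⟨⟨w.symm y, ?_⟩, ?_⟩
      · intro h
        apply h0
        have h2 : w.symm y = 0 := h
        rw [← hw0, ← h2, w.apply_symm_apply]
      · change ((w (w.symm y) : Fin N → ℝ) : OnePoint (Fin N → ℝ)) = _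
        rw [w.apply_symm_apply]
  have e1 : ({0}ᶜ : Set E) ≃ₜ {p : OnePoint (Fin N → ℝ) // sing p ∈ U0set N ∩ U1set N} :=
    hf.toHomeomorph.trans (Homeomorph.setCongr hr)
  have e2 := homeomorphUnitSphereProd E
  have : ContractibleSpace (Set.Ioi (0 : ℝ)) :=
    (convex_Ioi (0 : ℝ)).contractibleSpace ⟨1, by simp⟩
  obtain ⟨e3⟩ := ContractibleSpace.hequiv_unit (Set.Ioi (0 : ℝ))
  have e4 : ContinuousMap.HomotopyEquiv (Metric.sphere (0 : E) 1 × Set.Ioi (0 : ℝ))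
      (Metric.sphere (0 : E) 1) :=
    ((ContinuousMap.HomotopyEquiv.refl _).prodCongr e3).trans
      (Homeomorph.prodUnique _ _).toHomotopyEquiv
  exact weaklyEquivalent_of_homotopyEquiv
    ((retU (U0set N ∩ U1set N)
      (fun s u hu => ⟨scanH_U0 s u hu.1, scanH_U1 s u hu.2⟩)).trans
      ((e1.symm.trans e2).toHomotopyEquiv.trans e4))

lemma weak_all : WeaklyEquivalent (PhiInf N)
    (Metric.sphere (0 : EuclideanSpace ℝ (Fin (N + 1))) 1) :=
  weaklyEquivalent_of_homotopyEquiv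
    (retAll.trans (onePointEquivSphereOfFinrankEq (finrank_fin_add_one N)).toHomotopyEquiv)

end Final

/-- The scanning space `Φ_N^N` is covered by the open sets `U₀` and `U₁`, which are
weakly contractible with intersection weakly equivalent to `S^{N-1}`; consequently
`Φ_N^N` is weakly equivalent to `S^N`. -/
theorem stmt15 (N : ℕ) (hN : 1 ≤ N) :
    IsOpen (U0set N) ∧ IsOpen (U1set N) ∧ U0set N ∪ U1set N = Set.univ ∧
      WeaklyContractible (U0set N) ∧ WeaklyContractible (U1set N) ∧
      WeaklyEquivalent (↥(U0set N ∩ U1set N))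
        (Metric.sphere (0 : EuclideanSpace ℝ (Fin N)) 1) ∧
      WeaklyEquivalent (PhiInf N) (Metric.sphere (0 : EuclideanSpace ℝ (Fin (N + 1))) 1) := by
  have := contractible_U0 (N := N)
  have := contractible_U1 (N := N)
  exact ⟨isOpen_U0, isOpen_U1, U_cover, weaklyContractible_of_contractible,
    weaklyContractible_of_contractible, weak_inter, weak_all⟩
end
end
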